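/- For every integer n ≥ 7 there is no ideal right-angled convex hyperbolic n-polyhedron, i.e. no finite-volume right-angled convex hyperbolic n-polyhedron all of whose vertices are ideal. -/

import Mathlib

open scoped BigOperators

noncomputable section

/-- The Minkowski bilinear form `⟨x,y⟩ = -x₀y₀ + x₁y₁ + ⋯ + xₙyₙ` on `ℝ^{n+1}`. -/
def mink {n : ℕ} (x y : Fin (n + 1) → ℝ) : ℝ :=
  -(x 0 * y 0) + ∑ i : Fin n, x i.succ * y i.succ

/-- The hyperboloid model of the hyperbolic space `ℍⁿ`. -/
def Hyperboloid (n : ℕ) : Set (Fin (n + 1) → ℝ) :=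
  {x | mink x x = -1 ∧ 0 < x 0}

/-- The Klein projection `x ↦ (x₁/x₀, …, xₙ/x₀)` of the hyperboloid onto the unit ball. -/
def kleinMap {n : ℕ} (x : Fin (n + 1) → ℝ) : EuclideanSpace ℝ (Fin n) :=
  WithLp.toLp 2 fun i => x i.succ / x 0

/-- Dimension of a subset of a real vector space: the rank of its vector span. -/
def sdim {n : ℕ} (s : Set (EuclideanSpace ℝ (Fin n))) : ℕ :=
  Module.finrank ℝ (vectorSpan ℝ s)

/-- A convex hyperbolic `n`-polyhedron: a finite intersection of hyperbolic half-spaces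
`H_{eᵢ}⁻ = {x : ⟨eᵢ,x⟩ ≤ 0}` (with `⟨eᵢ,eᵢ⟩ = 1`) having nonempty interior
(equivalently, its Klein-model image has nonempty interior in `ℝⁿ`). -/
structure HypPolyhedron (n : ℕ) where
  m : ℕ
  e : Fin m → (Fin (n + 1) → ℝ)
  unit : ∀ i, mink (e i) (e i) = 1
  nonempty_int :
    (interior (kleinMap '' {x ∈ Hyperboloid n | ∀ i, mink (e i) x ≤ 0})).Nonempty

namespace HypPolyhedron

variable {n : ℕ} (P : HypPolyhedron n)

/-- The set of points of the polyhedron in the hyperboloid model. -/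
def carrier : Set (Fin (n + 1) → ℝ) :=
  {x ∈ Hyperboloid n | ∀ i, mink (P.e i) x ≤ 0}

/-- `P̄`: the closure of the Klein-model image of the polyhedron in the closed unit ball. -/
def cl : Set (EuclideanSpace ℝ (Fin n)) :=
  closure (kleinMap '' P.carrier)

/-- The `k`-faces of `P`: the `k`-dimensional (nonempty) exposed faces of `P̄`. -/
def faces (k : ℕ) : Set (Set (EuclideanSpace ℝ (Fin n))) :=
  {F | IsExposed ℝ P.cl F ∧ F.Nonempty ∧ sdim F = k}

/-- `a_k(P)`: the number of `k`-faces of `P`. -/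
def a (k : ℕ) : ℕ := (P.faces k).ncard

/-- Vertices of `P`: the points of `0`-dimensional exposed faces of `P̄`. -/
def verts : Set (EuclideanSpace ℝ (Fin n)) :=
  {v | IsExposed ℝ P.cl {v}}

/-- Ideal vertices: vertices lying on the unit sphere. -/
def idealVerts : Set (EuclideanSpace ℝ (Fin n)) :=
  {v ∈ P.verts | ‖v‖ = 1}

/-- Finite vertices: vertices lying in the open unit ball. -/
def finiteVerts : Set (EuclideanSpace ℝ (Fin n)) :=
  {v ∈ P.verts | ‖v‖ < 1}

/-- `v_∞(P)`: the number of ideal vertices of `P`. -/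
def vInf : ℕ := P.idealVerts.ncard

/-- The bounding hyperplane `H_e` contains the face `F`. -/
def faceInHyperplane (e : Fin (n + 1) → ℝ) (F : Set (EuclideanSpace ℝ (Fin n))) : Prop :=
  ∀ x ∈ P.carrier, kleinMap x ∈ F → mink e x = 0

/-- `P` is right-angled: whenever two distinct bounding hyperplanes both contain an
`(n-2)`-dimensional face of `P`, the corresponding unit normals are orthogonal,
i.e. the dihedral angle is `π/2`. -/
def IsRightAngled : Prop :=
  ∀ i j : Fin P.m, i ≠ j →
    (∃ F ∈ P.faces (n - 2), P.faceInHyperplane (P.e i) F ∧ P.faceInHyperplane (P.e j) F) →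
    mink (P.e i) (P.e j) = 0

/-- `P` has finite volume: `P̄` is the convex hull of its (finitely many) vertices. -/
def FiniteVolume : Prop :=
  P.verts.Finite ∧ P.cl = convexHull ℝ P.verts

/-- `P` is compact: finite volume and all vertices are finite. -/
def IsCompactPoly : Prop :=
  P.FiniteVolume ∧ ∀ v ∈ P.verts, ‖v‖ < 1

/-- `P` is ideal: finite volume and all vertices are ideal. -/
def IsIdeal : Prop :=
  P.FiniteVolume ∧ ∀ v ∈ P.verts, ‖v‖ = 1

end HypPolyhedron

/-- `ν(P) = a_{n-1}(P) + v_∞(P)` ranging over the family `𝒫ⁿ` of finite-volume non-compact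
right-angled convex hyperbolic `n`-polyhedra. -/
def nuSet (n : ℕ) : Set ℕ :=
  {m | ∃ P : HypPolyhedron n,
        P.FiniteVolume ∧ P.IsRightAngled ∧ ¬ P.IsCompactPoly ∧ P.a (n - 1) + P.vInf = m}

/-- `νₙ = sInf {ν(P) : P ∈ 𝒫ⁿ}` (with `sInf ∅ = 0`). -/
def nu (n : ℕ) : ℕ := sInf (nuSet n)

section MinkowskiAlgebra

variable {n : ℕ}

lemma mink_comm (x y : Fin (n + 1) → ℝ) : mink x y = mink y x := by
  simp only [mink, mul_comm]

lemma mink_add_right (x y z : Fin (n + 1) → ℝ) : mink x (y + z) = mink x y + mink x z := by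
  simp only [mink, Pi.add_apply, mul_add, Finset.sum_add_distrib]
  ring

lemma mink_smul_right (c : ℝ) (x y : Fin (n + 1) → ℝ) : mink x (c • y) = c * mink x y := by
  simp only [mink, Pi.smul_apply, smul_eq_mul, mul_add, Finset.mul_sum]
  congr 1
  · ring
  · exact Finset.sum_congr rfl fun i _ => by ring

/-- The Minkowski form against a fixed vector, as a linear functional. -/
def minkLin (x : Fin (n + 1) → ℝ) : (Fin (n + 1) → ℝ) →ₗ[ℝ] ℝ where
  toFun := mink x
  map_add' := mink_add_right x
  map_smul' c y := mink_smul_right c x y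

@[simp] lemma minkLin_apply (x y : Fin (n + 1) → ℝ) : minkLin x y = mink x y := rfl

lemma mink_sub_right (x y z : Fin (n + 1) → ℝ) : mink x (y - z) = mink x y - mink x z :=
  (minkLin x).map_sub y z

lemma mink_neg_right (x y : Fin (n + 1) → ℝ) : mink x (-y) = -mink x y :=
  (minkLin x).map_neg y

lemma mink_zero_right (x : Fin (n + 1) → ℝ) : mink x 0 = 0 := (minkLin x).map_zero

lemma mink_sum_right {κ : Type*} (s : Finset κ) (x : Fin (n + 1) → ℝ)
    (y : κ → Fin (n + 1) → ℝ) : mink x (∑ k ∈ s, y k) = ∑ k ∈ s, mink x (y k) :=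
  map_sum (minkLin x) y s

lemma mink_add_left (x y z : Fin (n + 1) → ℝ) : mink (x + y) z = mink x z + mink y z := by
  rw [mink_comm, mink_add_right, mink_comm z x, mink_comm z y]

lemma mink_smul_left (c : ℝ) (x y : Fin (n + 1) → ℝ) : mink (c • x) y = c * mink x y := by
  rw [mink_comm, mink_smul_right, mink_comm]

lemma mink_sub_left (x y z : Fin (n + 1) → ℝ) : mink (x - y) z = mink x z - mink y z := by
  rw [mink_comm, mink_sub_right, mink_comm z x, mink_comm z y]

lemma mink_neg_left (x y : Fin (n + 1) → ℝ) : mink (-x) y = -mink x y := by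
  rw [mink_comm, mink_neg_right, mink_comm]

lemma mink_sum_left {κ : Type*} (s : Finset κ) (x : Fin (n + 1) → ℝ)
    (y : κ → Fin (n + 1) → ℝ) : mink (∑ k ∈ s, y k) x = ∑ k ∈ s, mink (y k) x := by
  simp only [mink_comm _ x, mink_sum_right]

/-- The form is positive semidefinite on the orthogonal complement of a null vector `v`. -/
lemma mink_self_eq_of_orthogonal_null {v w : Fin (n + 1) → ℝ} (hv : mink v v = 0)
    (hvw : mink v w = 0) (h0 : v 0 = 1) :
    mink w w = ∑ i : Fin n, (w i.succ - w 0 * v i.succ) ^ 2 := by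
  have h1 : mink (w - w 0 • v) (w - w 0 • v) = mink w w := by
    simp only [mink_sub_left, mink_sub_right, mink_smul_left, mink_smul_right, hv, hvw,
      mink_comm w v]
    ring
  rw [← h1]
  simp [mink, h0, pow_two]

lemma mink_self_nonneg_of_orthogonal_null {v w : Fin (n + 1) → ℝ} (hv : mink v v = 0)
    (hvw : mink v w = 0) (h0 : v 0 = 1) : 0 ≤ mink w w := by
  rw [mink_self_eq_of_orthogonal_null hv hvw h0]
  positivity

/-- The radical of the form on the orthogonal complement of a null vector `v` is spanned by `v`. -/
lemma eq_smul_null_of_mink_self_nonpos {v w : Fin (n + 1) → ℝ} (hv : mink v v = 0)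
    (hvw : mink v w = 0) (h0 : v 0 = 1) (hw : mink w w ≤ 0) : w = w 0 • v := by
  rw [mink_self_eq_of_orthogonal_null hv hvw h0] at hw
  have h := (Finset.sum_eq_zero_iff_of_nonneg (fun i _ => sq_nonneg _)).1
    (le_antisymm hw (Finset.sum_nonneg fun i _ => sq_nonneg _))
  ext i
  refine Fin.cases ?_ (fun j => ?_) i
  · simp [h0]
  · have := pow_eq_zero_iff (two_ne_zero) |>.1 (h j (Finset.mem_univ j))
    simp only [Pi.smul_apply, smul_eq_mul]
    linarith

/-- Two null vectors in the affine chart `x₀ = 1` have nonpositive product. -/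
lemma mink_null_null {v w : Fin (n + 1) → ℝ} (hv : mink v v = 0) (hw : mink w w = 0)
    (hv0 : v 0 = 1) (hw0 : w 0 = 1) :
    mink v w = -(∑ i : Fin n, (v i.succ - w i.succ) ^ 2) / 2 := by
  have h1 : mink (v - w) (v - w) = -2 * mink v w := by
    simp only [mink_sub_left, mink_sub_right, hv, hw, mink_comm w v]
    ring
  have h2 : mink (v - w) (v - w) = ∑ i : Fin n, (v i.succ - w i.succ) ^ 2 := by
    simp [mink, hv0, hw0, pow_two]
  linarith

end MinkowskiAlgebra

/-- Redundant constraints may be discarded from a finite system of linear inequalities on a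
subspace, until each remaining one is the only tight one at some point. -/
lemma exists_irredundant_subsystem {M ι : Type*} [AddCommGroup M] [Module ℝ M] [DecidableEq ι]
    (f : ι → M →ₗ[ℝ] ℝ) (N : Submodule ℝ M) {p : M} (hp : p ∈ N) (S : Finset ι)
    (hpS : ∀ k ∈ S, f k p < 0) :
    ∃ T ⊆ S, (∀ y ∈ N, (∀ k ∈ T, f k y ≤ 0) → ∀ k ∈ S, f k y ≤ 0) ∧
      ∀ j ∈ T, ∃ x ∈ N, f j x = 0 ∧ ∀ k ∈ T, k ≠ j → f k x < 0 := by
  induction S using Finset.strongInduction with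
  | H S ih =>
    by_cases hred : ∃ j ∈ S, ∀ y ∈ N, (∀ k ∈ S.erase j, f k y ≤ 0) → f j y ≤ 0
    · obtain ⟨j, hj, hred⟩ := hred
      obtain ⟨T, hTS, hT, hTx⟩ := ih (S.erase j) (Finset.erase_ssubset hj)
        fun k hk => hpS k (Finset.mem_of_mem_erase hk)
      refine ⟨T, hTS.trans (Finset.erase_subset _ _), fun y hy hyT k hk => ?_, hTx⟩
      have h := hT y hy hyT
      by_cases hkj : k = j
      · exact hkj ▸ hred y hy h
      · exact h k (Finset.mem_erase.2 ⟨hkj, hk⟩)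
    · push Not at hred
      refine ⟨S, subset_rfl, fun y _ h => h, fun j hj => ?_⟩
      obtain ⟨y, hyN, hy, hyj⟩ := hred j hj
      refine ⟨f j y • p - f j p • y, N.sub_mem (N.smul_mem _ hp) (N.smul_mem _ hyN), ?_, ?_⟩
      · simp only [map_sub, map_smul, smul_eq_mul]
        ring
      · intro k hk hkj
        simp only [map_sub, map_smul, smul_eq_mul]
        nlinarith [hy k (Finset.mem_erase.2 ⟨hkj, hk⟩), hpS k hk, hpS j hj,
          mul_neg_of_pos_of_neg hyj (hpS k hk),
          mul_nonneg_of_nonpos_of_nonpos (hpS j hj).le (hy k (Finset.mem_erase.2 ⟨hkj, hk⟩))]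

/-- The cone `{X | ⟨eᵢ, X⟩ ≤ 0}` over an ideal right-angled polyhedron with lifted vertex set `V`.
In `right_angled`, the point `X` together with the constraints `T` exhibits an open piece of
`eᵢ^⊥ ∩ eⱼ^⊥` inside the cone. -/
structure IsIdealRightAngledCone {n m : ℕ} (e : Fin m → Fin (n + 1) → ℝ)
    (V : Finset (Fin (n + 1) → ℝ)) : Prop where
  unit : ∀ i, mink (e i) (e i) = 1
  height : ∀ v ∈ V, v 0 = 1
  null : ∀ v ∈ V, mink v v = 0
  mem : ∀ v ∈ V, ∀ i, mink (e i) v ≤ 0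
  cone : ∀ X, (∀ i, mink (e i) X ≤ 0) →
    ∃ c : (Fin (n + 1) → ℝ) → ℝ, (∀ v ∈ V, 0 ≤ c v) ∧ X = ∑ v ∈ V, c v • v
  interior : ∃ X, ∀ i, mink (e i) X < 0
  right_angled : ∀ i j, i ≠ j → ∀ (T : Finset (Fin m)) (X Z : Fin (n + 1) → ℝ),
    mink (e i) X = 0 → mink (e j) X = 0 → (∀ k ∈ T, mink (e k) X < 0) →
    mink (e i) Z = 0 → mink (e j) Z ≠ 0 →
    (∀ Y, mink (e i) Y = 0 → mink (e j) Y = 0 → (∀ k ∈ T, mink (e k) Y ≤ 0) →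
      ∀ k, mink (e k) Y ≤ 0) →
    mink (e i) (e j) = 0

/-- A presentation of the cone over an ideal polyhedron by constraints indexed by `S` whose
normals are pairwise orthogonal, parallel or ultraparallel. -/
structure IsReducedIdealCone {n m : ℕ} (e : Fin m → Fin (n + 1) → ℝ)
    (V : Finset (Fin (n + 1) → ℝ)) (S : Finset (Fin m)) : Prop where
  unit : ∀ i, mink (e i) (e i) = 1
  height : ∀ v ∈ V, v 0 = 1
  null : ∀ v ∈ V, mink v v = 0
  mem : ∀ v ∈ V, ∀ i ∈ S, mink (e i) v ≤ 0
  cone : ∀ X, (∀ i ∈ S, mink (e i) X ≤ 0) →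
    ∃ c : (Fin (n + 1) → ℝ) → ℝ, (∀ v ∈ V, 0 ≤ c v) ∧ X = ∑ v ∈ V, c v • v
  interior : ∃ X, ∀ i ∈ S, mink (e i) X < 0
  gram : ∀ i ∈ S, ∀ j ∈ S, i ≠ j → mink (e i) (e j) = 0 ∨ mink (e i) (e j) ≤ -1

namespace IsIdealRightAngledCone

variable {n m : ℕ} {e : Fin m → Fin (n + 1) → ℝ} {V : Finset (Fin (n + 1) → ℝ)}

/-- The cone is stable under orthogonal projection onto each of its facets. -/
lemma projection_mem (h : IsIdealRightAngledCone e V) {S : Finset (Fin m)}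
    (hS : ∀ X, (∀ i ∈ S, mink (e i) X ≤ 0) → ∀ i, mink (e i) X ≤ 0) {i : Fin m}
    {x : Fin (n + 1) → ℝ} (hxi : mink (e i) x = 0)
    (hxS : ∀ k ∈ S, k ≠ i → mink (e k) x < 0) {X : Fin (n + 1) → ℝ}
    (hX : ∀ k, mink (e k) X ≤ 0) (k : Fin m) :
    mink (e k) (X - mink (e i) X • e i) ≤ 0 := by
  classical
  obtain ⟨T, hTS, hT, hTx⟩ := exists_irredundant_subsystem (fun k => minkLin (e k))
    (LinearMap.ker (minkLin (e i))) (p := x) (by simpa using hxi) (S.erase i)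
    (fun k hk => by simpa using hxS k (Finset.mem_of_mem_erase hk) (Finset.ne_of_mem_erase hk))
  simp only [LinearMap.mem_ker, minkLin_apply] at hT hTx
  have hK : ∀ Y, mink (e i) Y = 0 → (∀ k ∈ T, mink (e k) Y ≤ 0) → ∀ k, mink (e k) Y ≤ 0 := by
    intro Y hY hYT
    refine hS Y fun l hl => ?_
    by_cases hli : l = i
    · exact hli ▸ hY.le
    · exact hT Y hY hYT l (Finset.mem_erase.2 ⟨hli, hl⟩)
  have horth : ∀ j ∈ T, mink (e i) (e j) = 0 := by
    intro j hj
    obtain ⟨y, hyi, hyj, hyT⟩ := hTx j hj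
    have hj' := Finset.mem_erase.1 (hTS hj)
    refine h.right_angled i j (Ne.symm hj'.1) (T.erase j) y x hyi hyj
      (fun k hk => hyT k (Finset.mem_of_mem_erase hk) (Finset.ne_of_mem_erase hk)) hxi
      (hxS j hj'.2 hj'.1).ne fun Y hYi hYj hYT => hK Y hYi fun k hk => ?_
    by_cases hkj : k = j
    · exact hkj ▸ hYj.le
    · exact hYT k (Finset.mem_erase.2 ⟨hkj, hk⟩)
  refine hK _ ?_ (fun j hj => ?_) k
  · rw [mink_sub_right, mink_smul_right, h.unit]
    ring
  · rw [mink_sub_right, mink_smul_right, mink_comm (e j) (e i), horth j hj]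
    simpa using hX j

lemma exists_reduced (h : IsIdealRightAngledCone e V) :
    ∃ S, IsReducedIdealCone e V S := by
  classical
  obtain ⟨X₀, hX₀⟩ := h.interior
  obtain ⟨S, -, hS, hSx⟩ := exists_irredundant_subsystem (fun k => minkLin (e k)) ⊤
    (p := X₀) trivial Finset.univ (fun k _ => by simpa using hX₀ k)
  simp only [Submodule.mem_top, minkLin_apply, forall_const, Finset.mem_univ, true_and] at hS hSx
  have hnonpos : ∀ i ∈ S, ∀ j ∈ S, i ≠ j → mink (e i) (e j) ≤ 0 := by
    intro i hi j hj hij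
    obtain ⟨x, hxi, hxS⟩ := hSx i hi
    obtain ⟨y, hyj, hyS⟩ := hSx j hj
    have hy : ∀ k, mink (e k) y ≤ 0 := hS y fun k hk => by
      by_cases hkj : k = j
      · exact hkj ▸ hyj.le
      · exact (hyS k hk hkj).le
    have h1 := h.projection_mem hS hxi hxS hy j
    rw [mink_sub_right, mink_smul_right, hyj, mink_comm (e j)] at h1
    have h2 := hyS i hi hij
    nlinarith
  refine ⟨S, h.unit, h.height, h.null, fun v hv i _ => h.mem v hv i,
    fun X hX => h.cone X (hS X hX), ⟨X₀, fun i _ => hX₀ i⟩, fun i hi j hj hij => ?_⟩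
  by_contra! hcon
  obtain ⟨hne, hlt⟩ := hcon
  set ρ := mink (e i) (e j) with hρ
  have hρ0 : ρ ≤ 0 := hnonpos i hi j hj hij
  have hρ2 : 0 < 1 - ρ ^ 2 := by nlinarith
  obtain ⟨x, hxi, hxS⟩ := hSx i hi
  have hsi := hX₀ i
  have hsj := hX₀ j
  set s := mink (e i) X₀
  set t := mink (e j) X₀
  set α := (-s + ρ * t) / (1 - ρ ^ 2) with hα
  set β := (-t + ρ * s) / (1 - ρ ^ 2) with hβ
  have hα0 : 0 ≤ α := div_nonneg (by nlinarith) hρ2.le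
  have hβ0 : 0 ≤ β := div_nonneg (by nlinarith) hρ2.le
  refine hne (h.right_angled i j hij ((S.erase i).erase j) (X₀ + α • e i + β • e j) x ?_ ?_ ?_
    hxi (hxS j hj hij.symm).ne fun Y hYi hYj hY => hS Y fun k hk => ?_)
  · simp only [mink_add_right, mink_smul_right, h.unit, ← hρ]
    change s + _ + _ = 0
    rw [hα, hβ]
    field_simp
    ring
  · simp only [mink_add_right, mink_smul_right, h.unit, mink_comm (e j) (e i), ← hρ]
    change t + _ + _ = 0
    rw [hα, hβ]
    field_simp
    ring
  · intro k hk
    simp only [Finset.mem_erase] at hk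
    simp only [mink_add_right, mink_smul_right]
    have h1 := hnonpos k hk.2.2 i hi hk.2.1
    have h2 := hnonpos k hk.2.2 j hj hk.1
    have h3 := hX₀ k
    nlinarith [mul_nonpos_of_nonneg_of_nonpos hα0 h1, mul_nonpos_of_nonneg_of_nonpos hβ0 h2]
  · by_cases hki : k = i
    · exact hki ▸ hYi.le
    by_cases hkj : k = j
    · exact hkj ▸ hYj.le
    exact hY k (Finset.mem_erase.2 ⟨hkj, Finset.mem_erase.2 ⟨hki, hk⟩⟩)

end IsIdealRightAngledCone

namespace IsReducedIdealCone

section Light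

variable {n m : ℕ} {e : Fin m → Fin (n + 1) → ℝ} {V : Finset (Fin (n + 1) → ℝ)}
  {S : Finset (Fin m)}

lemma mink_vertex_vertex_nonpos (h : IsReducedIdealCone e V S) {v w : Fin (n + 1) → ℝ}
    (hv : v ∈ V) (hw : w ∈ V) : mink v w ≤ 0 := by
  rw [mink_null_null (h.null v hv) (h.null w hw) (h.height v hv) (h.height w hw)]
  have : 0 ≤ ∑ i : Fin n, (v i.succ - w i.succ) ^ 2 := by positivity
  linarith

lemma mink_vertex_nonpos (h : IsReducedIdealCone e V S) {v X : Fin (n + 1) → ℝ}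
    (hv : v ∈ V) (hX : ∀ i ∈ S, mink (e i) X ≤ 0) : mink v X ≤ 0 := by
  obtain ⟨c, hc, rfl⟩ := h.cone X hX
  rw [mink_sum_right]
  refine Finset.sum_nonpos fun w hw => ?_
  rw [mink_smul_right]
  exact mul_nonpos_of_nonneg_of_nonpos (hc w hw) (h.mink_vertex_vertex_nonpos hv hw)

lemma mink_self_nonpos (h : IsReducedIdealCone e V S) {X : Fin (n + 1) → ℝ}
    (hX : ∀ i ∈ S, mink (e i) X ≤ 0) : mink X X ≤ 0 := by
  obtain ⟨c, hc, hXc⟩ := h.cone X hX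
  rw [show mink X X = mink (∑ v ∈ V, c v • v) X by rw [← hXc], mink_sum_left]
  refine Finset.sum_nonpos fun w hw => ?_
  rw [mink_smul_left]
  exact mul_nonpos_of_nonneg_of_nonpos (hc w hw) (h.mink_vertex_nonpos hw hX)

/-- A direction satisfying the constraints tight at `v` stays in the cone for a short while. -/
lemma exists_add_smul_mem (h : IsReducedIdealCone e V S) {v Z : Fin (n + 1) → ℝ} (hv : v ∈ V)
    (hZ : ∀ i ∈ S, mink (e i) v = 0 → mink (e i) Z ≤ 0) :
    ∃ t : ℝ, 0 < t ∧ ∀ i ∈ S, mink (e i) (v + t • Z) ≤ 0 := by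
  have hev : ∀ᶠ t : ℝ in nhdsWithin 0 (Set.Ioi 0), ∀ i ∈ S, mink (e i) (v + t • Z) ≤ 0 := by
    rw [Filter.eventually_all_finset]
    intro i hi
    simp only [mink_add_right, mink_smul_right]
    by_cases h0 : mink (e i) v = 0
    · filter_upwards [self_mem_nhdsWithin] with t ht
      rw [h0, zero_add]
      exact mul_nonpos_of_nonneg_of_nonpos (le_of_lt ht) (hZ i hi h0)
    · have hlt : mink (e i) v < 0 := lt_of_le_of_ne (h.mem v hv i hi) h0
      have hc : Continuous fun t : ℝ => mink (e i) v + t * mink (e i) Z := by fun_prop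
      have := (hc.tendsto 0).eventually_lt_const (u := 0) (by simpa using hlt)
      exact (this.filter_mono nhdsWithin_le_nhds).mono fun t ht => ht.le
  obtain ⟨t, ht, ht'⟩ := (hev.and self_mem_nhdsWithin).exists
  exact ⟨t, ht', ht⟩

/-- The normals tight at a vertex `v` span `v^⊥` modulo `v`. -/
lemma eq_smul_vertex_of_orthogonal (h : IsReducedIdealCone e V S) {v Z : Fin (n + 1) → ℝ}
    (hv : v ∈ V) (hvZ : mink v Z = 0) (hZ : ∀ i ∈ S, mink (e i) v = 0 → mink (e i) Z = 0) :
    Z = Z 0 • v := by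
  obtain ⟨t, ht, htZ⟩ := h.exists_add_smul_mem hv fun i hi hiv => (hZ i hi hiv).le
  have h1 := h.mink_self_nonpos htZ
  simp only [mink_add_left, mink_add_right, mink_smul_left, mink_smul_right, h.null v hv, hvZ,
    mink_comm Z v] at h1
  refine eq_smul_null_of_mink_self_nonpos (h.null v hv) hvZ (h.height v hv) ?_
  have ht2 : 0 < t * t := mul_pos ht ht
  nlinarith

lemma gram_at_vertex (h : IsReducedIdealCone e V S) {v : Fin (n + 1) → ℝ} (hv : v ∈ V)
    {i j : Fin m} (hi : i ∈ S) (hj : j ∈ S) (hij : i ≠ j) (hiv : mink (e i) v = 0)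
    (hjv : mink (e j) v = 0) : mink (e i) (e j) = 0 ∨ mink (e i) (e j) = -1 := by
  refine (h.gram i hi j hj hij).imp_right fun hle => le_antisymm hle ?_
  have h1 := mink_self_nonneg_of_orthogonal_null (w := e i + e j) (h.null v hv)
    (by rw [mink_add_right, mink_comm v, mink_comm v, hiv, hjv, add_zero]) (h.height v hv)
  simp only [mink_add_left, mink_add_right, h.unit, mink_comm (e j) (e i)] at h1
  linarith

lemma add_eq_smul_of_mink_eq_neg_one (h : IsReducedIdealCone e V S) {v : Fin (n + 1) → ℝ}
    (hv : v ∈ V) {i j : Fin m} (hiv : mink (e i) v = 0) (hjv : mink (e j) v = 0)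
    (hij : mink (e i) (e j) = -1) : e i + e j = (e i + e j) 0 • v := by
  refine eq_smul_null_of_mink_self_nonpos (h.null v hv)
    (by rw [mink_add_right, mink_comm v, mink_comm v, hiv, hjv, add_zero]) (h.height v hv) ?_
  simp only [mink_add_left, mink_add_right, h.unit, mink_comm (e j) (e i), hij]
  norm_num

lemma exists_opposite (h : IsReducedIdealCone e V S) {v : Fin (n + 1) → ℝ} (hv : v ∈ V)
    {i : Fin m} (hi : i ∈ S) (hiv : mink (e i) v = 0) :
    ∃ j ∈ S, mink (e j) v = 0 ∧ mink (e i) (e j) = -1 := by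
  by_contra! hcon
  have horth : ∀ j ∈ S, mink (e j) v = 0 → j ≠ i → mink (e j) (e i) = 0 := fun j hj hjv hji => by
    rw [mink_comm]
    exact (h.gram_at_vertex hv hi hj hji.symm hiv hjv).resolve_right (hcon j hj hjv)
  obtain ⟨t, ht, htZ⟩ := h.exists_add_smul_mem (Z := -e i) hv fun j hj hjv => by
    rw [mink_neg_right]
    by_cases hji : j = i
    · rw [hji, h.unit]
      norm_num
    · rw [horth j hj hjv hji, neg_zero]
  have h1 := h.mink_self_nonpos htZ
  simp only [mink_add_left, mink_add_right, mink_smul_left, mink_smul_right, mink_neg_left,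
    mink_neg_right, h.null v hv, hiv, mink_comm v (e i), h.unit] at h1
  nlinarith [mul_pos ht ht]

lemma opposite_unique (h : IsReducedIdealCone e V S) {v : Fin (n + 1) → ℝ} (hv : v ∈ V)
    {i j k : Fin m} (hiv : mink (e i) v = 0) (hj : j ∈ S) (hk : k ∈ S)
    (hjv : mink (e j) v = 0) (hij : mink (e i) (e j) = -1)
    (hik : mink (e i) (e k) = -1) (hkv : mink (e k) v = 0) : j = k := by
  by_contra hjk
  have h1 := h.add_eq_smul_of_mink_eq_neg_one hv hiv hjv hij
  have h2 : mink (e i + e j) (e k) = 0 := by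
    rw [h1, mink_smul_left, mink_comm, hkv, mul_zero]
  rw [mink_add_left, hik] at h2
  rcases h.gram j hj k hk hjk with h3 | h3 <;> linarith

end Light

end IsReducedIdealCone

/-- Coordinates adapted to an ideal vertex `v`: the constraints tight at `v` come in `d` parallel
pairs, so the link of `v` is the box `∏ₖ [-c k, 0]`. -/
structure IsBoxFrame {d m : ℕ} (e : Fin m → Fin (d + 2) → ℝ) (S : Finset (Fin m))
    (v : Fin (d + 2) → ℝ) (ε : Fin d → Bool → Fin m) (u : Fin (d + 2) → ℝ) (c : Fin d → ℝ) :
    Prop where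
  range : ∀ i, (i ∈ S ∧ mink (e i) v = 0) ↔ ∃ k s, ε k s = i
  inj : ∀ k s l t, ε k s = ε l t → k = l ∧ s = t
  orth : ∀ k s l t, k ≠ l → mink (e (ε k s)) (e (ε l t)) = 0
  opp : ∀ k, mink (e (ε k true)) (e (ε k false)) = -1
  pos : ∀ k, 0 < c k
  e_false : ∀ k, e (ε k false) = c k • v - e (ε k true)
  mink_v_u : mink v u = -1
  mink_e_u : ∀ k, mink (e (ε k true)) u = 0
  decomp : ∀ X, ∃ a : ℝ, X = a • v + (-mink v X) • u +
    ∑ k, mink (e (ε k true)) X • e (ε k true)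

namespace IsReducedIdealCone

lemma exists_boxFrame {d m : ℕ} {e : Fin m → Fin (d + 2) → ℝ} {V : Finset (Fin (d + 2) → ℝ)}
    {S : Finset (Fin m)} (h : IsReducedIdealCone e V S) {v : Fin (d + 2) → ℝ} (hv : v ∈ V) :
    ∃ ε u c, IsBoxFrame e S v ε u c := by
  classical
  set J : Finset (Fin m) := S.filter fun i => mink (e i) v = 0 with hJ
  have memJ : ∀ {i}, i ∈ J ↔ i ∈ S ∧ mink (e i) v = 0 := by simp [hJ]
  have hopp : ∀ i, ∃ j, i ∈ J → j ∈ J ∧ mink (e i) (e j) = -1 := fun i => by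
    by_cases hi : i ∈ J
    · obtain ⟨j, hj, hjv, hij⟩ := h.exists_opposite hv (memJ.1 hi).1 (memJ.1 hi).2
      exact ⟨j, fun _ => ⟨memJ.2 ⟨hj, hjv⟩, hij⟩⟩
    · exact ⟨i, fun hi' => absurd hi' hi⟩
  choose opp hopp using hopp
  have hJv : ∀ {i}, i ∈ J → mink (e i) v = 0 := fun hi => (memJ.1 hi).2
  have huniq : ∀ {i j}, i ∈ J → j ∈ J → mink (e i) (e j) = -1 → j = opp i :=
    fun {i j} hi hj hij => h.opposite_unique hv (hJv hi) (memJ.1 hj).1 (memJ.1 (hopp i hi).1).1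
      (hJv hj) hij (hopp i hi).2 (hJv (hopp i hi).1)
  have hinv : ∀ {i}, i ∈ J → opp (opp i) = i := fun {i} hi =>
    (huniq (hopp i hi).1 hi (by rw [mink_comm]; exact (hopp i hi).2)).symm
  have hne : ∀ {i}, i ∈ J → opp i ≠ i := fun {i} hi hii => by
    have := (hopp i hi).2
    rw [hii, h.unit] at this
    norm_num at this
  let κ : Type := {i : Fin m // i ∈ J ∧ i < opp i}
  let ε : κ → Bool → Fin m := fun k s => if s then k.1 else opp k.1
  have εt : ∀ k : κ, ε k true = k.1 := fun k => rfl
  have εf : ∀ k : κ, ε k false = opp k.1 := fun k => rfl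
  have hεJ : ∀ k s, ε k s ∈ J := fun k s => by
    cases s
    · exact (hopp _ k.2.1).1
    · exact k.2.1
  have hinj : ∀ k s l t, ε k s = ε l t → k = l ∧ s = t := by
    have key : ∀ k l : κ, ε k true ≠ ε l false := fun k l hkl => by
      rw [εt, εf] at hkl
      have h1 := k.2.2
      rw [hkl, hinv l.2.1] at h1
      exact lt_asymm h1 l.2.2
    rintro k (_ | _) l (_ | _) hkl
    · refine ⟨Subtype.ext ?_, rfl⟩
      rw [← hinv k.2.1, ← hinv l.2.1]
      exact congrArg opp hkl
    · exact absurd hkl.symm (key l k)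
    · exact absurd hkl (key k l)
    · exact ⟨Subtype.ext hkl, rfl⟩
  have hrange : ∀ i ∈ J, ∃ k s, ε k s = i := fun i hi => by
    rcases lt_or_gt_of_ne (hne hi) with hlt | hlt
    · exact ⟨⟨opp i, (hopp i hi).1, by rwa [hinv hi]⟩, false, hinv hi⟩
    · exact ⟨⟨i, hi, hlt⟩, true, rfl⟩
  have hεopp : ∀ k, mink (e (ε k true)) (e (ε k false)) = -1 := fun k => (hopp _ k.2.1).2
  have horth : ∀ k s l t, k ≠ l → mink (e (ε k s)) (e (ε l t)) = 0 := by
    intro k s l t hkl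
    refine (h.gram_at_vertex hv (memJ.1 (hεJ k s)).1 (memJ.1 (hεJ l t)).1
      (fun heq => hkl (hinj _ _ _ _ heq).1) (hJv (hεJ k s)) (hJv (hεJ l t))).resolve_right
      fun hcon => hkl ?_
    have h1 : ε k (!s) = opp (ε k s) := by
      cases s
      · exact (hinv k.2.1).symm
      · rfl
    have h2 := huniq (hεJ k s) (hεJ l t) hcon
    exact ((hinj _ _ _ _ (h2.trans h1.symm)).1).symm
  let E : κ → Fin (d + 2) → ℝ := fun k => e (ε k true)
  have hE : ∀ (k : κ) (f : κ → ℝ), ∑ l, f l * mink (E k) (E l) = f k := fun k f => by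
    rw [Finset.sum_eq_single k (fun l _ hl => by rw [horth k true l true hl.symm, mul_zero])
      (by simp), h.unit, mul_one]
  have hEv : ∀ k, mink (E k) v = 0 := fun k => hJv (hεJ k true)
  let c : κ → ℝ := fun k => (e (ε k true) + e (ε k false)) 0
  have hfalse : ∀ k, e (ε k false) = c k • v - e (ε k true) := fun k => by
    rw [← h.add_eq_smul_of_mink_eq_neg_one hv (hJv (hεJ k true)) (hJv (hεJ k false)) (hεopp k)]
    abel
  have hpos : ∀ k, 0 < c k := by
    intro k
    obtain ⟨X, hX⟩ := h.interior
    have h1 := hX _ (memJ.1 (hεJ k true)).1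
    have h2 := hX _ (memJ.1 (hεJ k false)).1
    have h3 := h.mink_vertex_nonpos hv fun i hi => (hX i hi).le
    rw [hfalse, mink_sub_left, mink_smul_left] at h2
    by_contra! hc
    nlinarith [mul_nonneg_of_nonpos_of_nonpos hc h3]
  let u₀ : Fin (d + 2) → ℝ := Pi.single 0 1
  have hvu₀ : mink v u₀ = -1 := by simp [mink, u₀, h.height v hv]
  let u : Fin (d + 2) → ℝ := u₀ - ∑ k, mink (E k) u₀ • E k
  have hvu : mink v u = -1 := by
    simp only [u, mink_sub_right, mink_sum_right, mink_smul_right, mink_comm v (E _), hEv, hvu₀]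
    simp
  have hEu : ∀ k, mink (E k) u = 0 := fun k => by
    simp only [u, mink_sub_right, mink_sum_right, mink_smul_right, hE]
    simp
  have hdecomp : ∀ X, ∃ a : ℝ, X = a • v + (-mink v X) • u + ∑ k, mink (E k) X • E k := by
    intro X
    set D := X - (-mink v X) • u - ∑ k, mink (E k) X • E k with hD
    have hvD : mink v D = 0 := by
      simp only [hD, mink_sub_right, mink_sum_right, mink_smul_right, mink_comm v (E _), hEv, hvu]
      simp
    have hED : ∀ k, mink (E k) D = 0 := fun k => by
      simp only [hD, mink_sub_right, mink_sum_right, mink_smul_right, hE, hEu]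
      simp
    have h1 : D = D 0 • v := h.eq_smul_vertex_of_orthogonal hv hvD fun i hi hiv => by
      obtain ⟨k, s, rfl⟩ := hrange i (memJ.2 ⟨hi, hiv⟩)
      cases s
      · rw [hfalse, mink_sub_left, mink_smul_left, hvD, hED k]
        ring
      · exact hED k
    refine ⟨D 0, ?_⟩
    rw [← h1, hD]
    abel
  have hcard : Fintype.card κ = d := by
    let Φ : (ℝ × ℝ × (κ → ℝ)) →ₗ[ℝ] (Fin (d + 2) → ℝ) :=
      { toFun := fun p => p.1 • v + p.2.1 • u + ∑ k, p.2.2 k • E k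
        map_add' := fun p q => by
          simp only [Prod.fst_add, Prod.snd_add, Pi.add_apply, add_smul, Finset.sum_add_distrib]
          abel
        map_smul' := fun r p => by
          simp only [Prod.smul_fst, Prod.smul_snd, Pi.smul_apply, smul_eq_mul, mul_smul, smul_add,
            Finset.smul_sum, RingHom.id_apply] }
    have hΦ : ∀ p, Φ p = p.1 • v + p.2.1 • u + ∑ k, p.2.2 k • E k := fun p => rfl
    have hsurj : Function.Surjective Φ := fun X => by
      obtain ⟨a, ha⟩ := hdecomp X
      exact ⟨(a, -mink v X, fun k => mink (E k) X), ha.symm⟩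
    have hinjΦ : Function.Injective Φ := by
      rw [injective_iff_map_eq_zero]
      rintro ⟨a, b, y⟩ hp
      rw [hΦ] at hp
      simp only at hp
      have hb : b = 0 := by
        have := congrArg (mink v) hp
        simp only [mink_add_right, mink_sum_right, mink_smul_right, mink_comm v (E _), hEv, hvu,
          h.null v hv, mink_zero_right] at this
        simpa using this
      have hy : y = 0 := by
        ext k
        have := congrArg (mink (E k)) hp
        simp only [mink_add_right, mink_sum_right, mink_smul_right, hE, hEv, hEu,
          mink_zero_right] at this
        simpa using this
      subst hb hy
      have := congrFun hp 0
      simp only [zero_smul, Pi.zero_apply, Finset.sum_const_zero, add_zero, Pi.smul_apply,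
        h.height v hv, smul_eq_mul, mul_one] at this
      simp [this]
    have := (LinearEquiv.ofBijective Φ ⟨hinjΦ, hsurj⟩).finrank_eq
    simp only [Module.finrank_prod, Module.finrank_self, Module.finrank_fintype_fun_eq_card,
      Fintype.card_fin] at this
    omega
  let φ : Fin d ≃ κ := (Fintype.equivFinOfCardEq hcard).symm
  refine ⟨fun k s => ε (φ k) s, u, fun k => c (φ k), ⟨fun i => ⟨fun hi => ?_, ?_⟩, ?_, ?_,
    fun k => hεopp _, fun k => hpos _, fun k => hfalse _, hvu, fun k => hEu _, fun X => ?_⟩⟩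
  · obtain ⟨k, s, hks⟩ := hrange i (memJ.2 hi)
    exact ⟨φ.symm k, s, by simpa using hks⟩
  · rintro ⟨k, s, rfl⟩
    exact memJ.1 (hεJ _ _)
  · intro k s l t hkl
    exact (hinj _ _ _ _ hkl).imp_left fun hh => φ.injective hh
  · intro k s l t hkl
    exact horth _ _ _ _ fun hh => hkl (φ.injective hh)
  · obtain ⟨a, ha⟩ := hdecomp X
    exact ⟨a, ha.trans (by rw [← Equiv.sum_comp φ])⟩

end IsReducedIdealCone

/-- `absSum d x = ∑ |x ± 1 ± ⋯ ± 1|`, over all `2 ^ d` choices of signs. -/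
def absSum : ℕ → ℤ → ℤ
  | 0, x => |x|
  | d + 1, x => absSum d (x + 1) + absSum d (x - 1)

lemma absSum_of_le (d : ℕ) : ∀ x : ℤ, (d : ℤ) ≤ |x| → absSum d x = 2 ^ d * |x| := by
  induction d with
  | zero => intro x _; simp [absSum]
  | succ d ih =>
    intro x hx
    push_cast at hx
    rw [absSum, ih, ih, pow_succ]
    · have : |x + 1| + |x - 1| = 2 * |x| := by grind
      linear_combination 2 ^ d * this
    · grind
    · grind

lemma absSum_six_le (x : ℤ) : absSum 6 x ≤ 120 + 20 * x ^ 2 := by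
  by_cases hx : 6 ≤ |x|
  · rw [absSum_of_le 6 x (by exact_mod_cast hx), ← sq_abs]
    nlinarith [sq_nonneg (5 * |x| - 8)]
  · have h1 := abs_lt.1 (not_le.1 hx)
    obtain ⟨h1, h2⟩ := h1
    interval_cases x <;> decide

lemma absSum_le (j : ℕ) : ∀ x : ℤ, absSum (6 + j) x ≤ 2 ^ j * (120 + 20 * j + 20 * x ^ 2) := by
  induction j with
  | zero => intro x; simpa using absSum_six_le x
  | succ j ih =>
    intro x
    have h1 := ih (x + 1)
    have h2 := ih (x - 1)
    rw [← add_assoc, absSum, pow_succ]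
    push_cast
    linarith

lemma three_mul_absSum_lt {d : ℕ} (hd : 6 ≤ d) : 3 * absSum d 0 < d * 2 ^ d := by
  obtain ⟨j, rfl⟩ := Nat.exists_eq_add_of_le hd
  have h := absSum_le j 0
  have h2 : (0 : ℤ) < 2 ^ j := by positivity
  have h3 : (0 : ℤ) ≤ j * 2 ^ j := by positivity
  rw [pow_add]
  push_cast
  linarith

/-- The value of the `k`-th coordinate character on a point of the cube. -/
def boolSign (b : Bool) : ℤ := if b then 1 else -1

lemma sum_abs_sign (d : ℕ) : ∀ (s : Fin d → ℤ) (_ : ∀ k, s k = 1 ∨ s k = -1) (x : ℤ),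
    ∑ σ : Fin d → Bool, |x + ∑ k, s k * boolSign (σ k)| = absSum d x := by
  induction d with
  | zero => intro s _ x; simp [absSum]
  | succ d ih =>
    intro s hs x
    rw [← (Fin.consEquiv fun _ : Fin (d + 1) => Bool).sum_comp, Fintype.sum_prod_type,
      Fintype.sum_bool, absSum]
    simp only [Fin.consEquiv_apply, Fin.sum_univ_succ, Fin.cons_zero, Fin.cons_succ, ← add_assoc]
    rw [ih _ (fun k => hs k.succ), ih _ (fun k => hs k.succ)]
    rcases hs 0 with h0 | h0 <;> simp [h0, boolSign, sub_eq_add_neg, add_comm]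

/-- A subset of the `d`-cube, `d ≥ 6`, that is monotone up to reversing coordinates
cuts less than a third of the edges. -/
lemma three_mul_card_cut_lt {d : ℕ} (hd : 6 ≤ d) (h : (Fin d → Bool) → Prop) [DecidablePred h]
    (hh : ∀ k, (∀ σ, h (Function.update σ k false) → h (Function.update σ k true)) ∨
      ∀ σ, h (Function.update σ k true) → h (Function.update σ k false)) :
    3 * (Finset.univ.filter fun p : Fin d × (Fin d → Bool) => p.2 p.1 = true ∧
        ¬ (h p.2 ↔ h (Function.update p.2 p.1 false))).card <
      (Finset.univ.filter fun p : Fin d × (Fin d → Bool) => p.2 p.1 = true).card := by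
  let H : (Fin d → Bool) → ℤ := fun σ => if h σ then 1 else 0
  have hflip : ∀ (k : Fin d) (F : (Fin d → Bool) → ℤ),
      ∑ σ, (if σ k = false then F σ else 0) =
        ∑ σ, if σ k = true then F (Function.update σ k false) else 0 := by
    intro k F
    rw [← Finset.sum_filter, ← Finset.sum_filter]
    refine Finset.sum_bij' (fun σ _ => Function.update σ k true)
      (fun σ _ => Function.update σ k false) ?_ ?_ ?_ ?_ ?_ <;>
      simp +contextual [Function.update_eq_self_iff]
    intro σ hσ
    rw [← hσ, Function.update_eq_self]
  have hsign : ∀ (k : Fin d) (F : (Fin d → Bool) → ℤ),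
      ∑ σ, boolSign (σ k) * F σ =
        ∑ σ, if σ k = true then F σ - F (Function.update σ k false) else 0 := by
    intro k F
    have h1 : ∀ σ : Fin d → Bool, boolSign (σ k) * F σ =
        (if σ k = true then F σ else 0) - if σ k = false then F σ else 0 := by
      intro σ; cases hσ : σ k <;> simp [boolSign]
    simp_rw [h1]
    rw [Finset.sum_sub_distrib, hflip, ← Finset.sum_sub_distrib]
    refine Finset.sum_congr rfl fun σ _ => ?_
    split_ifs <;> simp
  choose s hs hsH using fun k : Fin d => show ∃ s : ℤ, (s = 1 ∨ s = -1) ∧ ∀ σ : Fin d → Bool,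
      σ k = true → (if ¬ (h σ ↔ h (Function.update σ k false)) then 1 else 0) =
        s * (H σ - H (Function.update σ k false)) by
    rcases hh k with hk | hk
    · refine ⟨1, Or.inl rfl, fun σ hσ => ?_⟩
      have := hk σ
      rw [← hσ, Function.update_eq_self] at this
      by_cases h1 : h σ <;> by_cases h2 : h (Function.update σ k false) <;> simp_all [H]
    · refine ⟨-1, Or.inr rfl, fun σ hσ => ?_⟩
      have := hk σ
      rw [← hσ, Function.update_eq_self] at this
      by_cases h1 : h σ <;> by_cases h2 : h (Function.update σ k false) <;> simp_all [H]
  have hcut : ((Finset.univ.filter fun p : Fin d × (Fin d → Bool) => p.2 p.1 = true ∧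
        ¬ (h p.2 ↔ h (Function.update p.2 p.1 false))).card : ℤ) =
      ∑ σ, H σ * ∑ k, s k * boolSign (σ k) := by
    simp_rw [Finset.mul_sum]
    rw [Finset.sum_comm, Finset.natCast_card_filter, Fintype.sum_prod_type]
    refine Finset.sum_congr rfl fun k _ => ?_
    have := hsign k fun σ => s k * H σ
    calc _ = ∑ σ : Fin d → Bool,
          if σ k = true then s k * H σ - s k * H (Function.update σ k false) else 0 := by
          refine Finset.sum_congr rfl fun σ _ => ?_
          by_cases hσ : σ k = true
          · simp only [hσ, true_and, if_true]
            rw [hsH k σ hσ, mul_sub]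
          · simp [hσ]
      _ = _ := by
          rw [← this]
          exact Finset.sum_congr rfl fun σ _ => by ring
  have hzero : ∀ k : Fin d, ∑ σ : Fin d → Bool, boolSign (σ k) = 0 := fun k => by
    simpa using hsign k 1
  have htot : 2 * ((Finset.univ.filter fun p : Fin d × (Fin d → Bool) => p.2 p.1 = true).card : ℤ)
      = d * 2 ^ d := by
    rw [Finset.natCast_card_filter, Fintype.sum_prod_type, Finset.mul_sum]
    have : ∀ k : Fin d, 2 * ∑ σ : Fin d → Bool, (if σ k = true then (1 : ℤ) else 0) = 2 ^ d := by
      intro k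
      have h1 : ∀ σ : Fin d → Bool, 2 * (if σ k = true then (1 : ℤ) else 0) =
          1 + boolSign (σ k) := by
        intro σ; cases hσ : σ k <;> simp [boolSign]
      rw [Finset.mul_sum, Finset.sum_congr rfl fun σ _ => h1 σ, Finset.sum_add_distrib, hzero]
      simp
    rw [Finset.sum_congr rfl fun k _ => this k]
    simp
  have hsum : ∑ σ : Fin d → Bool, ∑ k, s k * boolSign (σ k) = 0 := by
    rw [Finset.sum_comm]
    exact Finset.sum_eq_zero fun k _ => by rw [← Finset.mul_sum, hzero, mul_zero]
  have hle : 2 * ∑ σ, H σ * ∑ k, s k * boolSign (σ k) ≤ absSum d 0 := by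
    have habs := sum_abs_sign d s hs 0
    simp only [zero_add] at habs
    rw [← habs, ← add_zero (∑ σ, |_|), ← hsum, ← Finset.sum_add_distrib,
      Finset.mul_sum]
    refine Finset.sum_le_sum fun σ _ => ?_
    generalize ∑ k, s k * boolSign (σ k) = t
    have h1 := le_abs_self t
    have h2 := neg_abs_le t
    by_cases hσ : h σ <;> simp [H, hσ] <;> linarith
  have h3 := three_mul_absSum_lt hd
  zify
  rw [hcut]
  linarith

namespace IsBoxFrame

variable {d m : ℕ} {e : Fin m → Fin (d + 2) → ℝ} {V : Finset (Fin (d + 2) → ℝ)}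
  {S : Finset (Fin m)} {v u : Fin (d + 2) → ℝ} {ε : Fin d → Bool → Fin m} {c : Fin d → ℝ}

lemma mem (hf : IsBoxFrame e S v ε u c) (k : Fin d) (s : Bool) : ε k s ∈ S :=
  ((hf.range _).2 ⟨k, s, rfl⟩).1

lemma tight (hf : IsBoxFrame e S v ε u c) (k : Fin d) (s : Bool) : mink (e (ε k s)) v = 0 :=
  ((hf.range _).2 ⟨k, s, rfl⟩).2

lemma mink_false (hf : IsBoxFrame e S v ε u c) (k : Fin d) (X : Fin (d + 2) → ℝ) :
    mink (e (ε k false)) X = c k * mink v X - mink (e (ε k true)) X := by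
  rw [hf.e_false, mink_sub_left, mink_smul_left]

/-- Every corner of the link of `v` is the direction of an edge ending at another vertex. -/
lemma exists_vertex (h : IsReducedIdealCone e V S) (hv : v ∈ V) (hf : IsBoxFrame e S v ε u c)
    (σ : Fin d → Bool) :
    ∃ w ∈ V, mink v w < 0 ∧ ∀ k, mink (e (ε k (σ k))) w = 0 := by
  set Z : Fin (d + 2) → ℝ := u + ∑ k, (if σ k then 0 else -c k) • e (ε k true) with hZ
  have hvZ : mink v Z = -1 := by
    rw [hZ, mink_add_right, mink_sum_right, hf.mink_v_u, Finset.sum_eq_zero, add_zero]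
    intro k _
    rw [mink_smul_right, mink_comm, hf.tight, mul_zero]
  have htZ : ∀ k, mink (e (ε k true)) Z = if σ k then 0 else -c k := by
    intro k
    rw [hZ, mink_add_right, mink_sum_right, hf.mink_e_u, zero_add, Finset.sum_eq_single k]
    · rw [mink_smul_right, h.unit, mul_one]
    · intro l _ hl
      rw [mink_smul_right, hf.orth _ _ _ _ hl.symm, mul_zero]
    · simp
  have hsZ : ∀ k s, mink (e (ε k s)) Z = if σ k = s then 0 else -c k := by
    intro k s
    cases s
    · rw [hf.mink_false, htZ, hvZ]
      cases σ k <;> simp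
    · rw [htZ]
  obtain ⟨t, ht, htX⟩ := h.exists_add_smul_mem (Z := Z) hv (by
    intro i hi hiv
    obtain ⟨k, s, rfl⟩ := (hf.range i).1 ⟨hi, hiv⟩
    rw [hsZ]
    split_ifs
    · exact le_rfl
    · exact neg_nonpos.2 (hf.pos k).le)
  obtain ⟨a, ha, hX⟩ := h.cone _ htX
  have hvX : mink v (v + t • Z) = -t := by
    rw [mink_add_right, mink_smul_right, h.null v hv, hvZ]; ring
  have hneg : ∑ w ∈ V, a w * mink v w < ∑ w ∈ V, 0 := by
    rw [hX, mink_sum_right] at hvX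
    simp only [mink_smul_right] at hvX
    rw [hvX, Finset.sum_const_zero]
    linarith
  obtain ⟨w, hw, hlt⟩ := Finset.exists_lt_of_sum_lt hneg
  have haw : 0 < a w := lt_of_le_of_ne (ha w hw) fun h0 => by simp [← h0] at hlt
  refine ⟨w, hw, by by_contra! hcon; nlinarith, fun k => ?_⟩
  have hk : mink (e (ε k (σ k))) (v + t • Z) = 0 := by
    rw [mink_add_right, mink_smul_right, hf.tight, hsZ]; simp
  rw [hX, mink_sum_right] at hk
  simp only [mink_smul_right] at hk
  have := (Finset.sum_eq_zero_iff_of_nonpos fun w' hw' =>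
    mul_nonpos_of_nonneg_of_nonpos (ha w' hw') (h.mem w' hw' _ (hf.mem k _))).1 hk w hw
  exact (mul_eq_zero.1 this).resolve_left haw.ne'

/-- The slope of the linear functional `g` along the edge of `v` pointing to the corner `σ`. -/
def slope (e : Fin m → Fin (d + 2) → ℝ) (ε : Fin d → Bool → Fin m) (u : Fin (d + 2) → ℝ)
    (c : Fin d → ℝ) (g : (Fin (d + 2) → ℝ) →ₗ[ℝ] ℝ) (σ : Fin d → Bool) : ℝ :=
  g u + ∑ k, if σ k then 0 else -(c k * g (e (ε k true)))

lemma slope_update_true (g : (Fin (d + 2) → ℝ) →ₗ[ℝ] ℝ) (σ : Fin d → Bool) (k : Fin d) :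
    slope e ε u c g (Function.update σ k true) =
      slope e ε u c g (Function.update σ k false) + c k * g (e (ε k true)) := by
  have key : ∀ b, slope e ε u c g (Function.update σ k b) =
      g u + ((if b then 0 else -(c k * g (e (ε k true)))) +
        ∑ l ∈ Finset.univ.erase k, if σ l then 0 else -(c l * g (e (ε l true)))) := by
    intro b
    rw [slope, ← Finset.add_sum_erase _ _ (Finset.mem_univ k), Function.update_self]
    congr 2
    refine Finset.sum_congr rfl fun l hl => ?_
    rw [Function.update_of_ne (Finset.ne_of_mem_erase hl)]
  rw [key, key]
  simp only [if_true, Bool.false_eq_true, if_false]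
  ring

/-- On the `2`-face spanned by the edges `σ` and `σ'` at `v` the functional `g` is a
nonnegative combination of its slopes along these edges. -/
lemma exists_combination (h : IsReducedIdealCone e V S)
    (hf : IsBoxFrame e S v ε u c) (g : (Fin (d + 2) → ℝ) →ₗ[ℝ] ℝ) (hgv : g v = 0)
    {σ : Fin d → Bool} {k : Fin d} (hσ : σ k = true) {w : Fin (d + 2) → ℝ} (hw : w ∈ V)
    (hwt : ∀ l, l ≠ k → mink (e (ε l (σ l))) w = 0) :
    ∃ a b : ℝ, 0 ≤ a ∧ 0 ≤ b ∧ g w = a * slope e ε u c g σ +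
      b * slope e ε u c g (Function.update σ k false) := by
  obtain ⟨a, ha⟩ := hf.decomp w
  have hy : ∀ l, l ≠ k → mink (e (ε l true)) w = -mink v w * if σ l then 0 else -c l := by
    intro l hl
    have := hwt l hl
    cases hs : σ l
    · rw [hs, hf.mink_false] at this
      simp; linarith
    · rw [hs] at this
      simp [this]
  have hg : g w = -mink v w * slope e ε u c g σ + mink (e (ε k true)) w * g (e (ε k true)) := by
    conv_lhs => rw [ha]
    simp only [map_add, map_smul, map_sum, smul_eq_mul, hgv, mul_zero, zero_add, slope]
    rw [← Finset.add_sum_erase _ _ (Finset.mem_univ k),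
      ← Finset.add_sum_erase (a := k) Finset.univ (fun l => if σ l then 0 else _)
        (Finset.mem_univ k), hσ, if_pos rfl, zero_add, mul_add, Finset.mul_sum, add_assoc,
      add_comm (∑ l ∈ _, -mink v w * _)]
    congr 2
    refine Finset.sum_congr rfl fun l hl => ?_
    rw [hy l (Finset.ne_of_mem_erase hl)]
    split_ifs <;> ring
  have hup : slope e ε u c g σ =
      slope e ε u c g (Function.update σ k false) + c k * g (e (ε k true)) := by
    rw [← slope_update_true, ← hσ, Function.update_eq_self]
  have h1 := h.mem w hw _ (hf.mem k true)
  have h2 := h.mem w hw _ (hf.mem k false)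
  rw [hf.mink_false] at h2
  have hc := hf.pos k
  refine ⟨-mink v w + mink (e (ε k true)) w / c k, -(mink (e (ε k true)) w / c k), ?_, ?_, ?_⟩
  · rw [← mul_nonneg_iff_of_pos_left hc]
    field_simp
    linarith
  · exact neg_nonneg.2 (div_nonpos_of_nonpos_of_nonneg h1 hc.le)
  · rw [hg, hup]
    field_simp
    ring

/-- The constraints defining the `2`-face at `v` spanned by the edges `p.2` and
`Function.update p.2 p.1 false`. -/
def faceSet (ε : Fin d → Bool → Fin m) (p : Fin d × (Fin d → Bool)) : Finset (Fin m) :=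
  (Finset.univ.erase p.1).image fun l => ε l (p.2 l)

lemma mem_faceSet {p : Fin d × (Fin d → Bool)} {i : Fin m} :
    i ∈ faceSet ε p ↔ ∃ l, l ≠ p.1 ∧ ε l (p.2 l) = i := by
  simp [faceSet]

lemma frame_mem_faceSet (hf : IsBoxFrame e S v ε u c) {p : Fin d × (Fin d → Bool)} {l : Fin d}
    {s : Bool} : ε l s ∈ faceSet ε p ↔ l ≠ p.1 ∧ p.2 l = s := by
  rw [mem_faceSet]
  constructor
  · rintro ⟨l', h1, h2⟩
    obtain ⟨rfl, rfl⟩ := hf.inj _ _ _ _ h2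
    exact ⟨h1, rfl⟩
  · rintro ⟨h1, rfl⟩
    exact ⟨l, h1, rfl⟩

lemma card_faceSet (hf : IsBoxFrame e S v ε u c) (p : Fin d × (Fin d → Bool)) :
    (faceSet ε p).card = d - 1 := by
  rw [faceSet, Finset.card_image_of_injective _ fun a b hab => (hf.inj _ _ _ _ hab).1,
    Finset.card_erase_of_mem (Finset.mem_univ _), Finset.card_univ, Fintype.card_fin]

lemma faceSet_injOn (hf : IsBoxFrame e S v ε u c) {p q : Fin d × (Fin d → Bool)}
    (hp : p.2 p.1 = true) (hq : q.2 q.1 = true) (hpq : faceSet ε p = faceSet ε q) : p = q := by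
  have key : ∀ l s, l ≠ p.1 ∧ p.2 l = s ↔ l ≠ q.1 ∧ q.2 l = s := fun l s => by
    rw [← hf.frame_mem_faceSet, ← hf.frame_mem_faceSet, hpq]
  have h1 : p.1 = q.1 := by
    by_contra hne
    exact ((key p.1 _).2 ⟨hne, rfl⟩).1 rfl
  refine Prod.ext h1 (funext fun l => ?_)
  by_cases hl : l = p.1
  · rw [hl, hp, h1, hq]
  · exact (((key l _).1 ⟨hl, rfl⟩).2).symm

/-- The sets of `d - 1` pairwise orthogonal constraints tight at `v` are the face sets. -/
lemma exists_faceSet_eq (hf : IsBoxFrame e S v ε u c) (hd : 0 < d) {T : Finset (Fin m)}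
    (hTS : T ⊆ S) (hT : T.card = d - 1)
    (horth : ∀ i ∈ T, ∀ j ∈ T, i ≠ j → mink (e i) (e j) = 0)
    (htight : ∀ i ∈ T, mink (e i) v = 0) :
    ∃ p : Fin d × (Fin d → Bool), p.2 p.1 = true ∧ faceSet ε p = T := by
  classical
  have : Nonempty (Fin d) := ⟨⟨0, hd⟩⟩
  choose! κ s hκ using fun i (hi : i ∈ T) => (hf.range i).1 ⟨hTS hi, htight i hi⟩
  have hinj : Set.InjOn κ T := by
    intro i hi j hj hij
    by_contra hne
    have hst : s i ≠ s j := fun hst => hne (by rw [← hκ i hi, ← hκ j hj, hij, hst])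
    have h0 := horth i hi j hj hne
    rw [← hκ i hi, ← hκ j hj, hij] at h0
    have hopp := hf.opp (κ j)
    cases hi' : s i <;> cases hj' : s j <;> rw [hi', hj'] at h0 hst
    · exact hst rfl
    · rw [mink_comm] at h0; linarith
    · linarith
    · exact hst rfl
  have hcard : (T.image κ).card = d - 1 := by rw [Finset.card_image_of_injOn hinj, hT]
  obtain ⟨k, hk⟩ : ∃ k, k ∉ T.image κ := by
    by_contra! hall
    rw [Finset.eq_univ_iff_forall.2 hall, Finset.card_univ, Fintype.card_fin] at hcard
    omega
  have himg : T.image κ = Finset.univ.erase k := by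
    refine Finset.eq_of_subset_of_card_le (fun l hl => ?_) ?_
    · exact Finset.mem_erase.2 ⟨fun h => hk (h ▸ hl), Finset.mem_univ _⟩
    · rw [hcard, Finset.card_erase_of_mem (Finset.mem_univ _), Finset.card_univ, Fintype.card_fin]
  refine ⟨(k, fun l => decide (l = k ∨ ε l true ∈ T)), by simp, ?_⟩
  refine Finset.eq_of_subset_of_card_le (fun i hi => ?_) (by rw [hT, hf.card_faceSet])
  obtain ⟨l, hl, rfl⟩ := mem_faceSet.1 hi
  have hl' : l ∈ T.image κ := by
    rw [himg]; exact Finset.mem_erase.2 ⟨hl, Finset.mem_univ _⟩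
  obtain ⟨j, hj, rfl⟩ := Finset.mem_image.1 hl'
  by_cases ht : ε (κ j) true ∈ T
  · simp [ht]
  · have hj2 := hκ j hj
    cases hs : s j
    · rw [hs] at hj2
      have hl2 : ¬ κ j = k := hl
      simpa [ht, hl2, hj2] using hj
    · rw [hs] at hj2
      exact absurd (hj2.symm ▸ hj) ht

end IsBoxFrame

namespace IsReducedIdealCone

variable {d m : ℕ} {e : Fin m → Fin (d + 2) → ℝ} {V : Finset (Fin (d + 2) → ℝ)}
  {S : Finset (Fin m)}

lemma vertices_nonempty (h : IsReducedIdealCone e V S) : V.Nonempty := by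
  by_contra hV
  rw [Finset.not_nonempty_iff_eq_empty] at hV
  have hzero : ∀ X, (∀ i ∈ S, mink (e i) X ≤ 0) → X = 0 := fun X hX => by
    obtain ⟨_, _, hX⟩ := h.cone X hX
    simpa [hV] using hX
  obtain ⟨X, hX⟩ := h.interior
  have hX0 := hzero X fun i hi => (hX i hi).le
  have h1 := hzero 1 fun i hi => absurd (hX i hi) (by rw [hX0, mink_zero_right]; exact lt_irrefl _)
  exact one_ne_zero h1

open Classical in
/-- The sets of `d - 1` pairwise orthogonal constraints, which index the `2`-faces. -/
def faceSets (e : Fin m → Fin (d + 2) → ℝ) (S : Finset (Fin m)) : Finset (Finset (Fin m)) :=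
  (S.powersetCard (d - 1)).filter fun T => ∀ i ∈ T, ∀ j ∈ T, i ≠ j → mink (e i) (e j) = 0

/-- The vertex `v` lies on the face defined by the constraints `T`. -/
def OnFace (e : Fin m → Fin (d + 2) → ℝ) (v : Fin (d + 2) → ℝ) (T : Finset (Fin m)) : Prop :=
  ∀ i ∈ T, mink (e i) v = 0

/-- The functional `f` attains its maximum or its minimum over the face `T` at `v`. -/
def IsExtremal (e : Fin m → Fin (d + 2) → ℝ) (V : Finset (Fin (d + 2) → ℝ))
    (f : (Fin (d + 2) → ℝ) →ₗ[ℝ] ℝ) (v : Fin (d + 2) → ℝ) (T : Finset (Fin m)) : Prop :=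
  (∀ w ∈ V, OnFace e w T → f w ≤ f v) ∨ ∀ w ∈ V, OnFace e w T → f v ≤ f w

lemma mem_faceSets_and_onFace_iff {v u : Fin (d + 2) → ℝ} {ε : Fin d → Bool → Fin m}
    {c : Fin d → ℝ} (hf : IsBoxFrame e S v ε u c) (hd : 0 < d) {T : Finset (Fin m)} :
    T ∈ faceSets e S ∧ OnFace e v T ↔
      ∃ p : Fin d × (Fin d → Bool), p.2 p.1 = true ∧ IsBoxFrame.faceSet ε p = T := by
  simp only [faceSets, Finset.mem_filter, Finset.mem_powersetCard]
  constructor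
  · rintro ⟨⟨⟨hTS, hT⟩, horth⟩, hv⟩
    exact hf.exists_faceSet_eq hd hTS hT horth hv
  · rintro ⟨p, hp, rfl⟩
    refine ⟨⟨⟨fun i hi => ?_, hf.card_faceSet p⟩, fun i hi j hj hij => ?_⟩, fun i hi => ?_⟩
    · obtain ⟨l, -, rfl⟩ := IsBoxFrame.mem_faceSet.1 hi
      exact hf.mem _ _
    · obtain ⟨l, -, rfl⟩ := IsBoxFrame.mem_faceSet.1 hi
      obtain ⟨l', -, rfl⟩ := IsBoxFrame.mem_faceSet.1 hj
      exact hf.orth _ _ _ _ fun hl => hij (by rw [hl])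
    · obtain ⟨l, -, rfl⟩ := IsBoxFrame.mem_faceSet.1 hi
      exact hf.tight _ _

open Classical in
/-- Every `2`-face has at least three vertices. -/
lemma three_le_card_onFace (h : IsReducedIdealCone e V S) (hd : 0 < d) {T : Finset (Fin m)}
    (hT : T ∈ faceSets e S) {v : Fin (d + 2) → ℝ} (hv : v ∈ V) (hvT : OnFace e v T) :
    3 ≤ (V.filter fun w => OnFace e w T).card := by
  obtain ⟨ε, u, c, hf⟩ := h.exists_boxFrame hv
  obtain ⟨⟨k, σ⟩, hσ, rfl⟩ := (mem_faceSets_and_onFace_iff hf hd).1 ⟨hT, hvT⟩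
  obtain ⟨w, hw, hvw, hwt⟩ := hf.exists_vertex h hv σ
  obtain ⟨w', hw', hvw', hwt'⟩ := hf.exists_vertex h hv (Function.update σ k false)
  have hne : ∀ {w}, mink v w < 0 → v ≠ w := fun hlt heq => by
    rw [← heq, h.null v hv] at hlt
    exact lt_irrefl _ hlt
  have hww' : w ≠ w' := by
    rintro rfl
    have h1 := hwt k
    have h2 := hwt' k
    rw [show σ k = true from hσ] at h1
    rw [Function.update_self, hf.mink_false, h1, sub_zero] at h2
    exact (mul_neg_of_pos_of_neg (hf.pos k) hvw).ne h2
  rw [← Finset.card_eq_three.2 ⟨v, w, w', hne hvw, hne hvw', hww', rfl⟩]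
  refine Finset.card_le_card fun x hx => ?_
  simp only [Finset.mem_insert, Finset.mem_singleton] at hx
  rcases hx with rfl | rfl | rfl
  · exact Finset.mem_filter.2 ⟨hv, hvT⟩
  · refine Finset.mem_filter.2 ⟨hw, fun i hi => ?_⟩
    obtain ⟨l, -, rfl⟩ := IsBoxFrame.mem_faceSet.1 hi
    exact hwt l
  · refine Finset.mem_filter.2 ⟨hw', fun i hi => ?_⟩
    obtain ⟨l, hl, rfl⟩ := IsBoxFrame.mem_faceSet.1 hi
    have := hwt' l
    rwa [Function.update_of_ne hl] at this

open Classical in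
/-- At most two vertices of a `2`-face are extremal for an injective functional. -/
lemma card_extremal_le_two {f : (Fin (d + 2) → ℝ) →ₗ[ℝ] ℝ} (hinj : Set.InjOn f V)
    (T : Finset (Fin m)) :
    (V.filter fun w => OnFace e w T ∧ IsExtremal e V f w T).card ≤ 2 := by
  let A := V.filter fun x => OnFace e x T ∧ ∀ w ∈ V, OnFace e w T → f w ≤ f x
  let B := V.filter fun x => OnFace e x T ∧ ∀ w ∈ V, OnFace e w T → f x ≤ f w
  have hA : A.card ≤ 1 := Finset.card_le_one.2 fun x hx y hy => by
    simp only [A, Finset.mem_filter] at hx hy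
    exact hinj hx.1 hy.1 (le_antisymm (hy.2.2 x hx.1 hx.2.1) (hx.2.2 y hy.1 hy.2.1))
  have hB : B.card ≤ 1 := Finset.card_le_one.2 fun x hx y hy => by
    simp only [B, Finset.mem_filter] at hx hy
    exact hinj hx.1 hy.1 (le_antisymm (hx.2.2 y hy.1 hy.2.1) (hy.2.2 x hx.1 hx.2.1))
  have hsub : (V.filter fun w => OnFace e w T ∧ IsExtremal e V f w T) ⊆ A ∪ B := by
    intro x hx
    simp only [A, B, Finset.mem_filter, Finset.mem_union] at hx ⊢
    rcases hx.2.2 with h | h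
    · exact Or.inl ⟨hx.1, hx.2.1, h⟩
    · exact Or.inr ⟨hx.1, hx.2.1, h⟩
  calc _ ≤ (A ∪ B).card := Finset.card_le_card hsub
    _ ≤ A.card + B.card := Finset.card_union_le _ _
    _ ≤ 2 := by omega

open Classical in
/-- Among the `2`-faces at `v`, less than a third do not have `v` as an extremal vertex. -/
lemma three_mul_card_not_extremal_lt (h : IsReducedIdealCone e V S) (hd : 6 ≤ d)
    (f : (Fin (d + 2) → ℝ) →ₗ[ℝ] ℝ) {v : Fin (d + 2) → ℝ} (hv : v ∈ V) :
    3 * ((faceSets e S).filter fun T => OnFace e v T ∧ ¬ IsExtremal e V f v T).card <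
      ((faceSets e S).filter fun T => OnFace e v T).card := by
  obtain ⟨ε, u, c, hf⟩ := h.exists_boxFrame hv
  have hiff := fun T => mem_faceSets_and_onFace_iff (T := T) hf (by omega)
  let g : (Fin (d + 2) → ℝ) →ₗ[ℝ] ℝ := f - f v • LinearMap.proj 0
  have hg : ∀ w ∈ V, g w = f w - f v := fun w hw => by simp [g, h.height w hw]
  have hgv : g v = 0 := by rw [hg v hv, sub_self]
  let G := IsBoxFrame.slope e ε u c g
  have hcube := three_mul_card_cut_lt hd (fun σ => 0 < G σ) fun k => by
    rcases le_total 0 (g (e (ε k true))) with h0 | h0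
    · left
      intro σ hσ
      have := IsBoxFrame.slope_update_true (e := e) (ε := ε) (u := u) (c := c) g σ k
      have := mul_nonneg (hf.pos k).le h0
      simp only [G] at hσ ⊢
      linarith
    · right
      intro σ hσ
      have := IsBoxFrame.slope_update_true (e := e) (ε := ε) (u := u) (c := c) g σ k
      have := mul_nonpos_of_nonneg_of_nonpos (hf.pos k).le h0
      simp only [G] at hσ ⊢
      linarith
  refine lt_of_le_of_lt (Nat.mul_le_mul_left 3 ?_) (hcube.trans_le ?_)
  · refine (Finset.card_le_card fun T hT => ?_).trans
      (Finset.card_image_le (f := IsBoxFrame.faceSet ε))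
    simp only [Finset.mem_filter] at hT
    obtain ⟨p, hp, rfl⟩ := (hiff T).1 ⟨hT.1, hT.2.1⟩
    refine Finset.mem_image.2 ⟨p, Finset.mem_filter.2 ⟨Finset.mem_univ _, hp, fun hcon => ?_⟩, rfl⟩
    have hcomb : ∀ w ∈ V, OnFace e w (IsBoxFrame.faceSet ε p) → ∃ a b : ℝ, 0 ≤ a ∧ 0 ≤ b ∧
        g w = a * G p.2 + b * G (Function.update p.2 p.1 false) := fun w hw hwT =>
      hf.exists_combination h g hgv hp hw fun l hl =>
        hwT _ (IsBoxFrame.mem_faceSet.2 ⟨l, hl, rfl⟩)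
    refine hT.2.2 ?_
    by_cases hpos : 0 < G p.2
    · refine Or.inr fun w hw hwT => ?_
      obtain ⟨a, b, ha, hb, hab⟩ := hcomb w hw hwT
      rw [hg w hw] at hab
      have := mul_nonneg ha hpos.le
      have := mul_nonneg hb (hcon.1 hpos).le
      linarith
    · refine Or.inl fun w hw hwT => ?_
      obtain ⟨a, b, ha, hb, hab⟩ := hcomb w hw hwT
      rw [hg w hw] at hab
      have := mul_nonpos_of_nonneg_of_nonpos ha (not_lt.1 hpos)
      have := mul_nonpos_of_nonneg_of_nonpos hb (not_lt.1 fun hlt => hpos (hcon.2 hlt))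
      linarith
  · refine Finset.card_le_card_of_injOn (IsBoxFrame.faceSet ε) (fun p hp => ?_) fun p hp q hq hpq =>
      hf.faceSet_injOn (by simpa using hp) (by simpa using hq) hpq
    simpa using (hiff _).2 ⟨p, by simpa using hp, rfl⟩

lemma exists_linear_injOn (V : Finset (Fin (d + 2) → ℝ)) :
    ∃ f : (Fin (d + 2) → ℝ) →ₗ[ℝ] ℝ, Set.InjOn f V := by
  obtain ⟨f, hf⟩ := Module.exists_dual_forall_apply_ne_zero (K := ℝ)
    (fun p : {p : V × V // p.1 ≠ p.2} => (p.1.1 : Fin (d + 2) → ℝ) - p.1.2)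
    fun p => sub_ne_zero.2 fun h => p.2 (Subtype.ext h)
  refine ⟨f, fun x hx y hy hxy => ?_⟩
  by_contra hne
  refine hf ⟨(⟨x, hx⟩, ⟨y, hy⟩), fun h => hne (congrArg Subtype.val h)⟩ ?_
  rw [map_sub, hxy, sub_self]

/-- There is no cone over an ideal right-angled polyhedron of dimension at least `7`. -/
lemma false_of_six_le (h : IsReducedIdealCone e V S) (hd : 6 ≤ d) : False := by
  classical
  obtain ⟨f, hinj⟩ := exists_linear_injOn V
  have hswap : ∀ (R : (Fin (d + 2) → ℝ) → Finset (Fin m) → Prop) [∀ v T, Decidable (R v T)],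
      ∑ v ∈ V, ((faceSets e S).filter fun T => R v T).card =
        ∑ T ∈ faceSets e S, (V.filter fun v => R v T).card := fun R _ =>
    Finset.sum_card_bipartiteAbove_eq_sum_card_bipartiteBelow R
  have hlt : ∑ v ∈ V, 3 * ((faceSets e S).filter fun T =>
      OnFace e v T ∧ ¬ IsExtremal e V f v T).card <
      ∑ v ∈ V, ((faceSets e S).filter fun T => OnFace e v T).card :=
    Finset.sum_lt_sum_of_nonempty h.vertices_nonempty fun v hv =>
      h.three_mul_card_not_extremal_lt hd f hv
  rw [← Finset.mul_sum, hswap fun v T => OnFace e v T ∧ ¬ IsExtremal e V f v T, hswap,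
    Finset.mul_sum] at hlt
  refine hlt.not_ge (Finset.sum_le_sum fun T hT => ?_)
  rcases (V.filter fun w => OnFace e w T).eq_empty_or_nonempty with h0 | ⟨v, hv⟩
  · simp [h0]
  · have hv := Finset.mem_filter.1 hv
    have h3 := h.three_le_card_onFace (by omega) hT hv.1 hv.2
    have h2 := card_extremal_le_two (e := e) hinj T
    have hsplit := Finset.card_filter_add_card_filter_not (s := V.filter fun w => OnFace e w T)
      fun w => IsExtremal e V f w T
    rw [Finset.filter_filter, Finset.filter_filter] at hsplit
    omega

end IsReducedIdealCone

/-- The embedding of directions of the Klein model as vectors of height zero. -/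
def directionLift (n : ℕ) : EuclideanSpace ℝ (Fin n) →ₗ[ℝ] (Fin (n + 1) → ℝ) where
  toFun y := Fin.cons 0 fun i => y i
  map_add' x y := by ext i; refine Fin.cases ?_ (fun i => ?_) i <;> simp
  map_smul' c x := by ext i; refine Fin.cases ?_ (fun i => ?_) i <;> simp

/-- The point of height one above a point of the Klein model. -/
def pointLift {n : ℕ} (x : EuclideanSpace ℝ (Fin n)) : Fin (n + 1) → ℝ := Fin.cons 1 fun i => x i

section lifts

variable {n : ℕ}

@[simp] lemma directionLift_zero (y : EuclideanSpace ℝ (Fin n)) : directionLift n y 0 = 0 := rfl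

@[simp] lemma directionLift_succ (y : EuclideanSpace ℝ (Fin n)) (i : Fin n) :
    directionLift n y i.succ = y i := rfl

@[simp] lemma pointLift_zero (x : EuclideanSpace ℝ (Fin n)) : pointLift x 0 = 1 := rfl

@[simp] lemma pointLift_succ (x : EuclideanSpace ℝ (Fin n)) (i : Fin n) :
    pointLift x i.succ = x i := rfl

lemma pointLift_injective : Function.Injective (pointLift (n := n)) := fun x y hxy => by
  ext i
  exact congrFun hxy i.succ

lemma pointLift_add (x y : EuclideanSpace ℝ (Fin n)) :
    pointLift (x + y) = pointLift x + directionLift n y := by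
  ext i
  refine Fin.cases ?_ (fun i => ?_) i <;> simp

lemma directionLift_sub (x y : EuclideanSpace ℝ (Fin n)) :
    directionLift n (x - y) = pointLift x - pointLift y := by
  ext i
  refine Fin.cases ?_ (fun i => ?_) i <;> simp

lemma pointLift_combination {a b : ℝ} (hab : a + b = 1) (x y : EuclideanSpace ℝ (Fin n)) :
    pointLift (a • x + b • y) = a • pointLift x + b • pointLift y := by
  ext i
  refine Fin.cases ?_ (fun i => ?_) i <;> simp [hab]

lemma smul_pointLift_kleinMap {X : Fin (n + 1) → ℝ} (hX : X 0 ≠ 0) :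
    X 0 • pointLift (kleinMap X) = X := by
  ext i
  refine Fin.cases ?_ (fun i => ?_) i <;> simp [kleinMap, mul_div_cancel₀ _ hX]

lemma kleinMap_smul_pointLift {c : ℝ} (hc : c ≠ 0) (x : EuclideanSpace ℝ (Fin n)) :
    kleinMap (c • pointLift x) = x := by
  ext i
  simp [kleinMap, hc]

lemma directionLift_tail {X : Fin (n + 1) → ℝ} (hX : X 0 = 0) :
    directionLift n (WithLp.toLp 2 fun i => X i.succ) = X := by
  ext i
  refine Fin.cases ?_ (fun i => ?_) i <;> simp [hX]

lemma mink_pointLift_self (x : EuclideanSpace ℝ (Fin n)) :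
    mink (pointLift x) (pointLift x) = ‖x‖ ^ 2 - 1 := by
  rw [EuclideanSpace.norm_sq_eq]
  simp only [mink, pointLift_zero, pointLift_succ, Real.norm_eq_abs, sq_abs, ← sq]
  ring

lemma continuous_mink_pointLift (f : Fin (n + 1) → ℝ) :
    Continuous fun x : EuclideanSpace ℝ (Fin n) => mink f (pointLift x) := by
  simp only [mink, pointLift_zero, pointLift_succ]
  fun_prop

lemma exists_mink_directionLift_pos {f : Fin (n + 1) → ℝ} (hf : mink f f = 1) :
    ∃ y, 0 < mink f (directionLift n y) := by
  refine ⟨WithLp.toLp 2 fun i => f i.succ, ?_⟩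
  simp only [mink, directionLift_zero, directionLift_succ] at hf ⊢
  nlinarith [mul_self_nonneg (f 0)]

end lifts

/-- A point of the unit sphere in the convex hull of a subset of the unit ball is in the subset. -/
lemma mem_of_mem_convexHull_of_norm_eq_one {n : ℕ} {A : Set (EuclideanSpace ℝ (Fin n))}
    (hA : ∀ v ∈ A, ‖v‖ = 1) {y : EuclideanSpace ℝ (Fin n)} (hy : y ∈ convexHull ℝ A)
    (hy1 : ‖y‖ = 1) : y ∈ A := by
  have hsub : convexHull ℝ A ⊆ Metric.closedBall 0 1 :=
    convexHull_min (fun v hv => by simp [hA v hv]) (convex_closedBall 0 1)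
  refine extremePoints_convexHull_subset (𝕜 := ℝ)
    (inter_extremePoints_subset_extremePoints_of_subset hsub ⟨hy, ?_⟩)
  exact StrictConvexSpace.sphere_subset_extremePoints_closedBall 0 one_ne_zero (by simpa using hy1)

/-- A nonempty relatively open subset of the unit sphere of dimension at least one is infinite. -/
lemma exists_mem_sphere_notMem {n : ℕ} (hn : 2 ≤ n) {A U : Set (EuclideanSpace ℝ (Fin n))}
    (hA : A.Finite) (hU : IsOpen U) {s : EuclideanSpace ℝ (Fin n)} (hs : ‖s‖ = 1) (hsU : s ∈ U) :
    ∃ y ∈ U, ‖y‖ = 1 ∧ y ∉ A := by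
  have hrank : 1 < Module.rank ℝ (EuclideanSpace ℝ (Fin n)) := by
    rw [← Module.finrank_eq_rank, finrank_euclideanSpace_fin]
    exact_mod_cast hn
  have hss : s ∈ Metric.sphere (0 : EuclideanSpace ℝ (Fin n)) 1 := by simpa using hs
  have hs0 : s ≠ -s := fun h =>
    ne_neg_of_mem_unit_sphere ℝ ⟨s, hss⟩ (Subtype.ext h)
  have hacc := (isPreconnected_sphere hrank 0 1).preperfect_of_nontrivial
    ⟨s, hss, -s, by simpa using hs, hs0⟩ s hss
  by_contra! hcon
  have hopen : IsOpen (U \ (A \ {s})) := hU.sdiff (hA.subset Set.sdiff_subset).isClosed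
  obtain ⟨y, ⟨⟨hyU, hyA⟩, hy1⟩, hys⟩ := accPt_iff_nhds.1 hacc _
    (hopen.mem_nhds ⟨hsU, fun h => h.2 rfl⟩)
  exact hyA ⟨hcon y hyU (by simpa using hy1), hys⟩

namespace HypPolyhedron

variable {n : ℕ} {P : HypPolyhedron n}

lemma mem_image_kleinMap_iff {y : EuclideanSpace ℝ (Fin n)} :
    y ∈ kleinMap '' P.carrier ↔ ‖y‖ < 1 ∧ ∀ i, mink (P.e i) (pointLift y) ≤ 0 := by
  constructor
  · rintro ⟨x, ⟨⟨hx1, hx0⟩, hx⟩, rfl⟩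
    have hlift := smul_pointLift_kleinMap hx0.ne'
    constructor
    · rw [← hlift, mink_smul_left, mink_smul_right, mink_pointLift_self] at hx1
      have : ‖kleinMap x‖ ^ 2 < 1 := by
        by_contra! hcon
        nlinarith [mul_nonneg hx0.le (mul_nonneg hx0.le (sub_nonneg.2 hcon))]
      exact lt_of_pow_lt_pow_left₀ 2 zero_le_one (by simpa using this)
    · intro i
      have := hx i
      rw [← hlift, mink_smul_right] at this
      exact nonpos_of_mul_nonpos_right this hx0
  · rintro ⟨hy1, hy⟩
    have hpos : 0 < 1 - ‖y‖ ^ 2 := by nlinarith [norm_nonneg y]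
    have hc : 0 < (√(1 - ‖y‖ ^ 2))⁻¹ := inv_pos.2 (Real.sqrt_pos.2 hpos)
    refine ⟨(√(1 - ‖y‖ ^ 2))⁻¹ • pointLift y, ⟨⟨?_, by simpa using hc⟩, fun i => ?_⟩,
      kleinMap_smul_pointLift hc.ne' y⟩
    · rw [mink_smul_left, mink_smul_right, mink_pointLift_self, ← mul_assoc, ← mul_inv,
        Real.mul_self_sqrt hpos.le]
      field_simp
      ring
    · rw [mink_smul_right]
      exact mul_nonpos_of_nonneg_of_nonpos hc.le (hy i)

lemma mink_nonpos_of_mem_cl {y : EuclideanSpace ℝ (Fin n)} (hy : y ∈ P.cl) (i : Fin P.m) :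
    mink (P.e i) (pointLift y) ≤ 0 :=
  closure_minimal (t := {y | mink (P.e i) (pointLift y) ≤ 0})
    (fun _ hx => (mem_image_kleinMap_iff.1 hx).2 i)
    (isClosed_le (continuous_mink_pointLift _) continuous_const) hy

lemma exists_interior_point (P : HypPolyhedron n) :
    ∃ p : EuclideanSpace ℝ (Fin n), ‖p‖ < 1 ∧ ∀ i, mink (P.e i) (pointLift p) < 0 := by
  obtain ⟨p, hp⟩ := P.nonempty_int
  have hpK : p ∈ kleinMap '' P.carrier := interior_subset hp
  refine ⟨p, (mem_image_kleinMap_iff.1 hpK).1, fun i => ?_⟩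
  obtain ⟨y, hy⟩ := exists_mink_directionLift_pos (P.unit i)
  have hcont : Filter.Tendsto (fun t : ℝ => p + t • y) (nhdsWithin 0 (Set.Ioi 0)) (nhds p) := by
    have : Continuous fun t : ℝ => p + t • y := by fun_prop
    exact (this.tendsto' 0 p (by simp)).mono_left nhdsWithin_le_nhds
  obtain ⟨t, ht, ht0⟩ := ((hcont.eventually (mem_interior_iff_mem_nhds.1 hp)).and
    self_mem_nhdsWithin).exists
  have h1 := (mem_image_kleinMap_iff (P := P)).1 ht |>.2 i
  rw [pointLift_add, map_smul, mink_add_right, mink_smul_right] at h1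
  have := mul_pos (Set.mem_Ioi.1 ht0) hy
  linarith

lemma mem_cl_of_norm_le_one {q : EuclideanSpace ℝ (Fin n)} (hq1 : ‖q‖ ≤ 1)
    (hq : ∀ i, mink (P.e i) (pointLift q) ≤ 0) : q ∈ P.cl := by
  obtain ⟨p, hp1, hp⟩ := P.exists_interior_point
  have hcont : Filter.Tendsto (fun t : ℝ => t • p + (1 - t) • q) (nhdsWithin 0 (Set.Ioi 0))
      (nhds q) := by
    have : Continuous fun t : ℝ => t • p + (1 - t) • q := by fun_prop
    exact (this.tendsto' 0 q (by simp)).mono_left nhdsWithin_le_nhds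
  refine mem_closure_of_tendsto hcont ?_
  have hlt : ∀ᶠ t : ℝ in nhdsWithin 0 (Set.Ioi 0), t < 1 :=
    nhdsWithin_le_nhds (Iio_mem_nhds zero_lt_one)
  filter_upwards [self_mem_nhdsWithin, hlt] with t ht0 ht1
  rw [Set.mem_Ioi] at ht0
  refine mem_image_kleinMap_iff.2 ⟨?_, fun i => ?_⟩
  · calc ‖t • p + (1 - t) • q‖ ≤ ‖t • p‖ + ‖(1 - t) • q‖ := norm_add_le _ _
      _ = t * ‖p‖ + (1 - t) * ‖q‖ := by
        rw [norm_smul, norm_smul, Real.norm_of_nonneg ht0.le, Real.norm_of_nonneg (by linarith)]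
      _ < 1 := by nlinarith
  · rw [pointLift_combination (by ring), mink_add_right, mink_smul_right, mink_smul_right]
    have := mul_nonpos_of_nonneg_of_nonpos ht0.le (hp i).le
    have := mul_nonpos_of_nonneg_of_nonpos (sub_nonneg.2 ht1.le) (hq i)
    linarith

/-- The polyhedron in `ℝⁿ` cut out by the constraints of an ideal polyhedron is contained in the
unit ball. -/
lemma IsIdeal.norm_le_one (hP : P.IsIdeal) (hn : 2 ≤ n) {q : EuclideanSpace ℝ (Fin n)}
    (hq : ∀ i, mink (P.e i) (pointLift q) ≤ 0) : ‖q‖ ≤ 1 := by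
  by_contra! hq1
  obtain ⟨p, hp1, hp⟩ := P.exists_interior_point
  have hcont : Continuous fun t : ℝ => ‖(1 - t) • p + t • q‖ := by fun_prop
  obtain ⟨t, ⟨ht0, ht1⟩, ht⟩ := intermediate_value_Icc (zero_le_one (α := ℝ)) hcont.continuousOn
    (show (1 : ℝ) ∈ Set.Icc _ _ by simpa using ⟨hp1.le, hq1.le⟩)
  have ht1' : t < 1 := lt_of_le_of_ne ht1 fun h => by
    rw [h] at ht
    simp at ht
    linarith
  obtain ⟨y, hyU, hy1, hyV⟩ := exists_mem_sphere_notMem hn hP.1.1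
    (U := ⋂ i, {y | mink (P.e i) (pointLift y) < 0})
    (isOpen_iInter_of_finite fun i =>
      isOpen_lt (continuous_mink_pointLift _) continuous_const) ht (Set.mem_iInter.2 fun i => by
        rw [Set.mem_ofPred_eq, pointLift_combination (by ring), mink_add_right, mink_smul_right,
          mink_smul_right]
        have := mul_neg_of_pos_of_neg (sub_pos.2 ht1') (hp i)
        have := mul_nonpos_of_nonneg_of_nonpos ht0 (hq i)
        linarith)
  refine hyV (mem_of_mem_convexHull_of_norm_eq_one hP.2 ?_ hy1)
  rw [← hP.1.2]
  exact mem_cl_of_norm_le_one hy1.le fun i => le_of_lt (Set.mem_iInter.1 hyU i)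

lemma IsIdeal.mem_cl_iff (hP : P.IsIdeal) (hn : 2 ≤ n) {q : EuclideanSpace ℝ (Fin n)} :
    q ∈ P.cl ↔ ∀ i, mink (P.e i) (pointLift q) ≤ 0 :=
  ⟨mink_nonpos_of_mem_cl, fun hq => mem_cl_of_norm_le_one (hP.norm_le_one hn hq) hq⟩

lemma IsIdeal.eq_zero_of_height_eq_zero (hP : P.IsIdeal) (hn : 2 ≤ n) {X : Fin (n + 1) → ℝ}
    (hX : ∀ i, mink (P.e i) X ≤ 0) (hX0 : X 0 = 0) : X = 0 := by
  obtain ⟨p, hp1, hp⟩ := P.exists_interior_point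
  rw [← directionLift_tail hX0] at hX ⊢
  generalize (WithLp.toLp 2 fun i => X i.succ : EuclideanSpace ℝ (Fin n)) = y at hX ⊢
  suffices hy : y = 0 by rw [hy, map_zero]
  by_contra hy
  have hy' : 0 < ‖y‖ := norm_pos_iff.2 hy
  have hball := hP.norm_le_one hn (q := p + (3 / ‖y‖) • y) fun i => by
    rw [pointLift_add, map_smul, mink_add_right, mink_smul_right]
    have := mul_nonpos_of_nonneg_of_nonpos (by positivity : 0 ≤ 3 / ‖y‖) (hX i)
    linarith [hp i]
  have h3 : ‖(3 / ‖y‖) • y‖ = 3 := by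
    rw [norm_smul, Real.norm_of_nonneg (by positivity)]
    field_simp
  have := norm_sub_le (p + (3 / ‖y‖) • y) p
  rw [add_sub_cancel_left] at this
  linarith

lemma IsIdeal.height_nonneg (hP : P.IsIdeal) (hn : 2 ≤ n) {X : Fin (n + 1) → ℝ}
    (hX : ∀ i, mink (P.e i) X ≤ 0) : 0 ≤ X 0 := by
  by_contra! hX0
  obtain ⟨p, hp1, hp⟩ := P.exists_interior_point
  have hlt : ∀ i, mink (P.e i) (X + (-X 0) • pointLift p) < 0 := fun i => by
    rw [mink_add_right, mink_smul_right]
    have := mul_neg_of_pos_of_neg (neg_pos.2 hX0) (hp i)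
    linarith [hX i]
  have hzero := hP.eq_zero_of_height_eq_zero hn (fun i => (hlt i).le) (by simp)
  rw [hzero] at hlt
  have h1 := hP.eq_zero_of_height_eq_zero hn (X := Fin.cons 0 1)
    (fun i => absurd (hlt i) (by rw [mink_zero_right]; exact lt_irrefl _)) rfl
  exact one_ne_zero (α := ℝ) (congrFun h1 (Fin.succ ⟨0, by omega⟩))

end HypPolyhedron

namespace HypPolyhedron

variable {n : ℕ} {P : HypPolyhedron n}

/-- If the constraints `T` cut out the cone within `eᵢ^⊥ ∩ eⱼ^⊥` and hold strictly at a point of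
this subspace, then the facets `i` and `j` meet in a face of codimension two. -/
lemma IsIdeal.exists_codim_two_face (hP : P.IsIdeal) (hn : 3 ≤ n) {i j : Fin P.m}
    {T : Finset (Fin P.m)} {X Z : Fin (n + 1) → ℝ}
    (hXi : mink (P.e i) X = 0) (hXj : mink (P.e j) X = 0) (hXT : ∀ k ∈ T, mink (P.e k) X < 0)
    (hZi : mink (P.e i) Z = 0) (hZj : mink (P.e j) Z ≠ 0)
    (hT : ∀ Y, mink (P.e i) Y = 0 → mink (P.e j) Y = 0 → (∀ k ∈ T, mink (P.e k) Y ≤ 0) →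
      ∀ k, mink (P.e k) Y ≤ 0) :
    ∃ F ∈ P.faces (n - 2), P.faceInHyperplane (P.e i) F ∧ P.faceInHyperplane (P.e j) F := by
  have hn2 : 2 ≤ n := by omega
  have hXK := hT X hXi hXj fun k hk => (hXT k hk).le
  have hX0 : X 0 ≠ 0 := by
    intro h0
    have hX := hP.eq_zero_of_height_eq_zero hn2 hXK h0
    have hK : ∀ Y, mink (P.e i) Y = 0 → mink (P.e j) Y = 0 → ∀ k, mink (P.e k) Y ≤ 0 :=
      fun Y hYi hYj => hT Y hYi hYj fun k hk => by
        have := hXT k hk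
        rw [hX, mink_zero_right] at this
        exact absurd this (lt_irrefl _)
    have hker : LinearMap.ker ((minkLin (P.e i)).prod (minkLin (P.e j))) ≠ ⊥ :=
      LinearMap.ker_ne_bot_of_finrank_lt (by simp; omega)
    obtain ⟨Y, hY, hY0⟩ := Submodule.exists_mem_ne_zero_of_ne_bot hker
    simp only [LinearMap.mem_ker, LinearMap.prod_apply, Function.prod_apply, Prod.mk_eq_zero,
      minkLin_apply] at hY
    have h1 := hP.height_nonneg hn2 (hK Y hY.1 hY.2)
    have h2 := hP.height_nonneg hn2 (hK (-Y) (by rw [mink_neg_right, hY.1, neg_zero])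
      (by rw [mink_neg_right, hY.2, neg_zero]))
    rw [Pi.neg_apply] at h2
    exact hY0 (hP.eq_zero_of_height_eq_zero hn2 (hK Y hY.1 hY.2) (by linarith))
  have hXpos : 0 < X 0 := lt_of_le_of_ne (hP.height_nonneg hn2 hXK) hX0.symm
  set x := kleinMap X with hx
  have hlift := smul_pointLift_kleinMap hX0
  have hmx : ∀ k, X 0 * mink (P.e k) (pointLift x) = mink (P.e k) X := fun k => by
    rw [← mink_smul_right, hlift]
  have hxi : mink (P.e i) (pointLift x) = 0 :=
    (mul_eq_zero.1 ((hmx i).trans hXi)).resolve_left hX0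
  have hxj : mink (P.e j) (pointLift x) = 0 :=
    (mul_eq_zero.1 ((hmx j).trans hXj)).resolve_left hX0
  have hxT : ∀ k ∈ T, mink (P.e k) (pointLift x) < 0 := fun k hk =>
    neg_of_mul_neg_right ((hmx k).trans_lt (hXT k hk)) hXpos.le
  let F : Set (EuclideanSpace ℝ (Fin n)) :=
    {y | y ∈ P.cl ∧ mink (P.e i) (pointLift y) = 0 ∧ mink (P.e j) (pointLift y) = 0}
  have hFmem : ∀ y, mink (P.e i) (pointLift y) = 0 → mink (P.e j) (pointLift y) = 0 →
      (∀ k ∈ T, mink (P.e k) (pointLift y) ≤ 0) → y ∈ F := fun y hyi hyj hyT =>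
    ⟨(hP.mem_cl_iff hn2).2 (hT _ hyi hyj hyT), hyi, hyj⟩
  have hxF : x ∈ F := hFmem x hxi hxj fun k hk => (hxT k hk).le
  let φ : Fin P.m → EuclideanSpace ℝ (Fin n) →ₗ[ℝ] ℝ := fun k =>
    minkLin (P.e k) ∘ₗ directionLift n
  have hφ : ∀ k y, φ k y = mink (P.e k) (directionLift n y) := fun _ _ => rfl
  have hφsub : ∀ k y z, φ k (y - z) = mink (P.e k) (pointLift y) - mink (P.e k) (pointLift z) :=
    fun k y z => by rw [hφ, directionLift_sub, mink_sub_right]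
  have hexp : IsExposed ℝ P.cl F := by
    refine fun _ => ⟨LinearMap.toContinuousLinearMap (φ i + φ j), ?_⟩
    ext y
    constructor
    · rintro ⟨hy, hyi, hyj⟩
      refine ⟨hy, fun z hz => ?_⟩
      have h1 := hφsub i z y
      have h2 := hφsub j z y
      rw [map_sub] at h1 h2
      have h3 := mink_nonpos_of_mem_cl hz i
      have h4 := mink_nonpos_of_mem_cl hz j
      simp only [LinearMap.coe_toContinuousLinearMap', LinearMap.add_apply]
      linarith
    · rintro ⟨hy, hmax⟩
      have h0 := hmax x hxF.1
      simp only [LinearMap.coe_toContinuousLinearMap', LinearMap.add_apply] at h0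
      have h1 := hφsub i x y
      have h2 := hφsub j x y
      rw [map_sub] at h1 h2
      have h3 := mink_nonpos_of_mem_cl hy i
      have h4 := mink_nonpos_of_mem_cl hy j
      exact ⟨hy, by linarith, by linarith⟩
  have hspan : vectorSpan ℝ F = LinearMap.ker ((φ i).prod (φ j)) := by
    refine le_antisymm (Submodule.span_le.2 ?_) fun y hy => ?_
    · rintro _ ⟨y, hy, z, hz, rfl⟩
      simp only [vsub_eq_sub, SetLike.mem_coe, LinearMap.mem_ker, LinearMap.prod_apply,
        Function.prod_apply, Prod.mk_eq_zero, hφsub]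
      rw [hy.2.1, hy.2.2, hz.2.1, hz.2.2]
      simp
    · simp only [LinearMap.mem_ker, LinearMap.prod_apply, Function.prod_apply, Prod.mk_eq_zero,
        hφ] at hy
      have hline : ∀ k (t : ℝ), mink (P.e k) (pointLift (x + t • y)) =
          mink (P.e k) (pointLift x) + t * mink (P.e k) (directionLift n y) := fun k t => by
        rw [pointLift_add, map_smul, mink_add_right, mink_smul_right]
      have hev : ∀ᶠ t : ℝ in nhdsWithin 0 (Set.Ioi 0), ∀ k ∈ T,
          mink (P.e k) (pointLift (x + t • y)) < 0 := by
        refine nhdsWithin_le_nhds ((Finset.eventually_all T).2 fun k hk => ?_)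
        have hcont : Continuous fun t : ℝ => mink (P.e k) (pointLift (x + t • y)) :=
          (continuous_mink_pointLift _).comp (by fun_prop)
        exact hcont.continuousAt.eventually_lt continuousAt_const (by simpa using hxT k hk)
      obtain ⟨t, ht, ht0⟩ := (hev.and self_mem_nhdsWithin).exists
      have htF : x + t • y ∈ F := hFmem _ (by rw [hline, hxi, hy.1]; simp)
        (by rw [hline, hxj, hy.2]; simp) fun k hk => (ht k hk).le
      have hmem := vsub_mem_vectorSpan ℝ htF hxF
      rw [vsub_eq_sub, add_sub_cancel_left] at hmem
      exact (Submodule.smul_mem_iff _ (ne_of_gt ht0)).1 hmem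
  have hsurj : Function.Surjective ((φ i).prod (φ j)) := by
    obtain ⟨y, hy⟩ := exists_mink_directionLift_pos (P.unit i)
    obtain ⟨z, hzi, hzj⟩ : ∃ z, φ i z = 0 ∧ φ j z ≠ 0 := by
      have hZ : directionLift n (WithLp.toLp 2 fun l => (Z - Z 0 • pointLift x) l.succ) =
          Z - Z 0 • pointLift x := directionLift_tail (by simp)
      refine ⟨WithLp.toLp 2 fun l => (Z - Z 0 • pointLift x) l.succ, ?_, ?_⟩
      · rw [hφ, hZ, mink_sub_right, mink_smul_right, hxi, hZi]
        simp
      · rw [hφ, hZ, mink_sub_right, mink_smul_right, hxj]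
        simpa using hZj
    rw [← hφ] at hy
    rintro ⟨a, b⟩
    refine ⟨(a / φ i y) • y + ((b - a / φ i y * φ j y) / φ j z) • z, ?_⟩
    simp only [LinearMap.prod_apply, Function.prod_apply, map_add, map_smul, hzi]
    refine Prod.ext ?_ ?_
    · simp [hy.ne']
    · simp [hzj]
  have hdim : sdim F = n - 2 := by
    have hrn := LinearMap.finrank_range_add_finrank_ker ((φ i).prod (φ j))
    rw [LinearMap.range_eq_top.2 hsurj, finrank_top, Module.finrank_prod, Module.finrank_self,
      finrank_euclideanSpace_fin] at hrn
    rw [sdim, hspan]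
    omega
  have hface : ∀ k, (∀ y ∈ F, mink (P.e k) (pointLift y) = 0) → P.faceInHyperplane (P.e k) F :=
    fun k hk y hy hyF => by
      rw [← smul_pointLift_kleinMap hy.1.2.ne', mink_smul_right, hk _ hyF, mul_zero]
  exact ⟨F, ⟨hexp, ⟨x, hxF⟩, hdim⟩, hface i fun y hy => hy.2.1, hface j fun y hy => hy.2.2⟩

open Classical in
/-- The cone over an ideal right-angled polyhedron. -/
lemma IsIdeal.isIdealRightAngledCone (hP : P.IsIdeal) (hR : P.IsRightAngled) (hn : 3 ≤ n) :
    IsIdealRightAngledCone P.e (hP.1.1.toFinset.image pointLift) where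
  unit := P.unit
  height v hv := by
    obtain ⟨y, -, rfl⟩ := Finset.mem_image.1 hv
    rfl
  null v hv := by
    obtain ⟨y, hy, rfl⟩ := Finset.mem_image.1 hv
    rw [mink_pointLift_self, hP.2 y (by simpa using hy)]
    norm_num
  mem v hv := by
    obtain ⟨y, hy, rfl⟩ := Finset.mem_image.1 hv
    refine mink_nonpos_of_mem_cl ?_
    rw [hP.1.2]
    exact subset_convexHull ℝ _ (by simpa using hy)
  cone X hX := by
    have hn2 : 2 ≤ n := by omega
    by_cases hX0 : X 0 = 0
    · refine ⟨0, fun _ _ => le_rfl, ?_⟩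
      simpa using hP.eq_zero_of_height_eq_zero hn2 hX hX0
    have hpos : 0 < X 0 := lt_of_le_of_ne (hP.height_nonneg hn2 hX) (Ne.symm hX0)
    have hlift := smul_pointLift_kleinMap hX0
    have hmem : kleinMap X ∈ P.cl := (hP.mem_cl_iff hn2).2 fun i => by
      have := hX i
      rw [← hlift, mink_smul_right] at this
      exact nonpos_of_mul_nonpos_right this hpos
    rw [hP.1.2, ← hP.1.1.coe_toFinset, Finset.mem_convexHull'] at hmem
    obtain ⟨w, hw0, hw1, hw⟩ := hmem
    refine ⟨fun v => X 0 * w (Function.invFun pointLift v), fun v hv => ?_, ?_⟩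
    · obtain ⟨y, hy, rfl⟩ := Finset.mem_image.1 hv
      simp only [Function.leftInverse_invFun pointLift_injective _]
      exact mul_nonneg hpos.le (hw0 y hy)
    · rw [Finset.sum_image fun _ _ _ _ h => pointLift_injective h]
      simp only [Function.leftInverse_invFun pointLift_injective _, mul_smul, ← Finset.smul_sum]
      conv_lhs => rw [← hlift, ← hw]
      congr 1
      ext l
      refine Fin.cases ?_ (fun l => ?_) l
      · simp [hw1]
      · simp
  interior := by
    obtain ⟨p, -, hp⟩ := P.exists_interior_point
    exact ⟨_, hp⟩
  right_angled i j hij T X Z hXi hXj hXT hZi hZj hT :=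
    hR i j hij (hP.exists_codim_two_face hn hXi hXj hXT hZi hZj hT)

end HypPolyhedron

/-- There are no ideal right-angled convex hyperbolic polyhedra in `ℍⁿ` for `n ≥ 7`. -/
theorem no_ideal_right_angled_polyhedron (n : ℕ) (hn : 7 ≤ n) :
    ¬ ∃ P : HypPolyhedron n, P.IsRightAngled ∧ P.IsIdeal := by
  rintro ⟨P, hR, hP⟩
  obtain ⟨d, rfl⟩ : ∃ d, n = d + 1 := ⟨n - 1, by omega⟩
  obtain ⟨S, hS⟩ := (hP.isIdealRightAngledCone hR (by omega)).exists_reduced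
  exact hS.false_of_six_le (by omega)
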